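/- arXiv:0705.3751 — 2 statements merged into one kernel-verified Lean document; each statement's English description precedes it below -/
import Mathlib

section
/- Every polynomial computed by an arithmetic formula of size n over a field K can be expressed as the permanent of a matrix of size at most (n+1)×(n+1) and treewidth at most 2, whose entries are 0, 1, or variables of the formula. -/
open scoped Classical

/-! ### Arithmetic formulas -/

inductive Formula (K : Type) (ν : Type) where
  | const : K → Formula K ν
  | var : ν → Formula K ν
  | add : Formula K ν → Formula K ν → Formula K ν
  | mul : Formula K ν → Formula K ν → Formula K ν

namespace Formula
variable {K ν : Type}

/-- Number of gates of a formula. -/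
def size : Formula K ν → ℕ
  | const _ => 1
  | var _ => 1
  | add f g => f.size + g.size + 1
  | mul f g => f.size + g.size + 1

/-- Depth of a formula: longest path from an input to the output. -/
def depth : Formula K ν → ℕ
  | const _ => 0
  | var _ => 0
  | add f g => max f.depth g.depth + 1
  | mul f g => max f.depth g.depth + 1

def eval [CommRing K] (x : ν → K) : Formula K ν → K
  | const c => c
  | var v => x v
  | add f g => f.eval x + g.eval x
  | mul f g => f.eval x * g.eval x

/-- The polynomial computed by a formula. -/
noncomputable def toPoly [CommRing K] : Formula K ν → MvPolynomial ν K
  | const c => MvPolynomial.C c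
  | var v => MvPolynomial.X v
  | add f g => f.toPoly + g.toPoly
  | mul f g => f.toPoly * g.toPoly

/-- The set of variables appearing in a formula. -/
def varSet : Formula K ν → Set ν
  | const _ => ∅
  | var v => {v}
  | add f g => f.varSet ∪ g.varSet
  | mul f g => f.varSet ∪ g.varSet

/-- All constants of the formula are 0 or 1. -/
def ZeroOneConsts [Zero K] [One K] : Formula K ν → Prop
  | const c => c = 0 ∨ c = 1
  | var _ => True
  | add f g => f.ZeroOneConsts ∧ g.ZeroOneConsts
  | mul f g => f.ZeroOneConsts ∧ g.ZeroOneConsts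

end Formula

/-! ### Arithmetic circuits -/

inductive CGate (K ν : Type) (n : ℕ) where
  | const : K → CGate K ν n
  | var : ν → CGate K ν n
  | add : Fin n → Fin n → CGate K ν n
  | mul : Fin n → Fin n → CGate K ν n

def CGate.IsInput {K ν : Type} {n : ℕ} : CGate K ν n → Prop
  | .const _ => True
  | .var _ => True
  | _ => False

/-- An arithmetic circuit: an acyclic digraph of gates, the last gate being the output. -/
structure Circuit (K ν : Type) where
  size : ℕ
  pos : 0 < size
  gate : Fin size → CGate K ν size
  wf : ∀ i a b, (gate i = .add a b ∨ gate i = .mul a b) → a < i ∧ b < i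

namespace Circuit
variable {K ν : Type}

def output (c : Circuit K ν) : Fin c.size := ⟨c.size - 1, Nat.sub_lt c.pos Nat.one_pos⟩

def evalGate {R : Type} [CommRing R] (c : Circuit K ν) (cst : K → R) (x : ν → R) :
    Fin c.size → R := fun i =>
  match h : c.gate i with
  | .const a => cst a
  | .var v => x v
  | .add a b =>
      have hlt := c.wf i a b (Or.inl h)
      c.evalGate cst x a + c.evalGate cst x b
  | .mul a b =>
      have hlt := c.wf i a b (Or.inr h)
      c.evalGate cst x a * c.evalGate cst x b
termination_by i => i.1
decreasing_by
  · exact hlt.1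
  · exact hlt.2
  · exact hlt.1
  · exact hlt.2

/-- The value computed (at the output gate) by a circuit. -/
def eval {R : Type} [CommRing R] (c : Circuit K ν) (cst : K → R) (x : ν → R) : R :=
  c.evalGate cst x c.output

/-- The polynomial computed by a circuit. -/
noncomputable def evalP [CommRing K] (c : Circuit K ν) : MvPolynomial ν K :=
  c.eval MvPolynomial.C MvPolynomial.X

def depthGate (c : Circuit K ν) : Fin c.size → ℕ := fun i =>
  match h : c.gate i with
  | .const _ => 0
  | .var _ => 0
  | .add a b =>
      have hlt := c.wf i a b (Or.inl h)
      max (c.depthGate a) (c.depthGate b) + 1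
  | .mul a b =>
      have hlt := c.wf i a b (Or.inr h)
      max (c.depthGate a) (c.depthGate b) + 1
termination_by i => i.1
decreasing_by
  · exact hlt.1
  · exact hlt.2
  · exact hlt.1
  · exact hlt.2

/-- Depth of a circuit: length of the longest input-to-output path. -/
def depth (c : Circuit K ν) : ℕ := c.depthGate c.output

/-- A circuit is skew if every multiplication gate has at least one argument
which is an input gate. -/
def IsSkew (c : Circuit K ν) : Prop :=
  ∀ i a b, c.gate i = .mul a b → (c.gate a).IsInput ∨ (c.gate b).IsInput

/-- `arrow j i` : there is an arrow from gate `j` to gate `i`. -/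
def arrow (c : Circuit K ν) (j i : Fin c.size) : Prop :=
  ∃ a b, (c.gate i = .add a b ∨ c.gate i = .mul a b) ∧ (j = a ∨ j = b)

/-- The subcircuit rooted at `g` is connected to the rest of the circuit only through
the arrow from `g` to `i`. -/
def OnlyConn (c : Circuit K ν) (g i : Fin c.size) : Prop :=
  ∀ j, Relation.ReflTransGen c.arrow j g →
    ∀ k, c.arrow j k → Relation.ReflTransGen c.arrow k g ∨ (j = g ∧ k = i)

/-- A circuit is weakly skew if for every multiplication gate, at least one of the incoming
arrows comes from an input gate or from a subcircuit whose only connection to the rest of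
the circuit is through this arrow. -/
def IsWeaklySkew (c : Circuit K ν) : Prop :=
  ∀ i a b, c.gate i = .mul a b →
    ((c.gate a).IsInput ∨ c.OnlyConn a i) ∨ ((c.gate b).IsInput ∨ c.OnlyConn b i)

end Circuit

/-! ### Treewidth -/

/-- `G` admits a tree-decomposition of width at most `k`. -/
def HasTreewidthAtMost {V : Type} (G : SimpleGraph V) (k : ℕ) : Prop :=
  ∃ (n : ℕ) (T : SimpleGraph (Fin n)) (X : Fin n → Finset V),
    T.IsTree ∧
    (∀ t, (X t).card ≤ k + 1) ∧
    (∀ v : V, ∃ t, v ∈ X t) ∧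
    (∀ u v : V, G.Adj u v → ∃ t, u ∈ X t ∧ v ∈ X t) ∧
    (∀ v : V, (T.induce {t | v ∈ X t}).Connected)

/-- The underlying undirected simple graph of a digraph (loops discarded). -/
def underlyingGraph {V : Type} (E : V → V → Prop) : SimpleGraph V :=
  SimpleGraph.fromRel E

/-- The underlying undirected graph of the support digraph `G_M` of a matrix. -/
def supportGraph {m : ℕ} {R : Type} [Zero R] (M : Matrix (Fin m) (Fin m) R) :
    SimpleGraph (Fin m) :=
  SimpleGraph.fromRel (fun i j => M i j ≠ 0)

/-! ### Permanent, hamiltonian, cycle covers -/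

/-- The permanent of a square matrix. -/
def perm {m : ℕ} {R : Type} [CommRing R] (M : Matrix (Fin m) (Fin m) R) : R :=
  ∑ σ : Equiv.Perm (Fin m), ∏ i, M i (σ i)

/-- The hamiltonian polynomial of a square matrix: sum over permutations that are a
single cycle on all of `Fin m`. -/
noncomputable def ham {m : ℕ} {R : Type} [CommRing R] (M : Matrix (Fin m) (Fin m) R) : R :=
  ∑ σ ∈ Finset.univ.filter
      (fun σ : Equiv.Perm (Fin m) => σ.IsCycle ∧ σ.support = Finset.univ),
    ∏ i, M i (σ i)

/-- A cycle cover of the digraph with edge relation `E`: a set of edges of `E` forming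
vertex-disjoint directed cycles (loops allowed) covering every vertex exactly once,
i.e. every vertex has exactly one outgoing and exactly one incoming edge in `C`. -/
def IsCycleCover {V : Type} (E : V → V → Prop) (C : Finset (V × V)) : Prop :=
  (∀ e ∈ C, E e.1 e.2) ∧ (∀ v : V, ∃! u, (v, u) ∈ C) ∧ (∀ v : V, ∃! u, (u, v) ∈ C)

/-- The sum of weights of all cycle covers. -/
noncomputable def cycleCoverSum {V K : Type} [Fintype V] [DecidableEq V] [CommRing K]
    (E : V → V → Prop) (w : V → V → K) : K :=
  ∑ C : Finset (V × V), if IsCycleCover E C then ∏ e ∈ C, w e.1 e.2 else 0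

/-! ### Weighted DAGs and path sums -/

/-- The weight of a path (given as the list of its vertices). -/
def pathWeight {V K : Type} [CommRing K] (w : V → V → K) (l : List V) : K :=
  ((l.zip l.tail).map fun p => w p.1 p.2).prod

/-- `l` is (the vertex list of) a directed path from `s` to `t`. -/
def IsPathFromTo {V : Type} (E : V → V → Prop) (s t : V) (l : List V) : Prop :=
  l.Chain' E ∧ l.head? = some s ∧ l.getLast? = some t

/-- The sum of the weights of all directed paths from `s` to `t`. -/
noncomputable def SW {V K : Type} [Fintype V] [DecidableEq V] [CommRing K]
    (E : V → V → Prop) (w : V → V → K) (s t : V) : K :=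
  ∑ l : {l : List V // l.Nodup},
    if IsPathFromTo E s t l.1 then pathWeight w l.1 else 0

/-- A digraph is acyclic if it has no directed cycle (in particular no loop). -/
def Acyclic {V : Type} (E : V → V → Prop) : Prop :=
  ∀ v : V, ¬ Relation.TransGen E v v

/-! ### Perfect matchings, SPM, planarity -/

/-- `M` is (the edge set of) a perfect matching of `G`. -/
def IsPerfectMatchingSet {V : Type} (G : SimpleGraph V) (M : Finset (Sym2 V)) : Prop :=
  (∀ e ∈ M, e ∈ G.edgeSet) ∧ ∀ v : V, ∃! e, e ∈ M ∧ v ∈ e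

/-- The sum of the weights of all perfect matchings of `G`. -/
noncomputable def SPM {V K : Type} [Fintype V] [DecidableEq V] [CommRing K]
    (G : SimpleGraph V) (w : Sym2 V → K) : K :=
  ∑ M : Finset (Sym2 V), if IsPerfectMatchingSet G M then ∏ e ∈ M, w e else 0

/-- A graph is planar if it has a drawing in the plane: vertices are mapped to distinct
points, edges to simple arcs joining their endpoints, arcs meet vertices only at their
endpoints, and two arcs of distinct edges do not meet except possibly at endpoints. -/
def IsPlanar {V : Type} (G : SimpleGraph V) : Prop :=
  ∃ (f : V → ℝ × ℝ) (γ : ∀ u v : V, G.Adj u v → Path (f u) (f v)),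
    Function.Injective f ∧
    (∀ u v h, Function.Injective fun t : unitInterval => (γ u v h) t) ∧
    (∀ u v h (t : unitInterval), t ≠ 0 → t ≠ 1 → ∀ x : V, (γ u v h) t ≠ f x) ∧
    (∀ u v h u' v' h', s(u, v) ≠ s(u', v') →
      ∀ (t t' : unitInterval), t ≠ 0 → t ≠ 1 → t' ≠ 0 → t' ≠ 1 →
        (γ u v h) t ≠ (γ u' v' h') t')


/-! ### Permanents of block matrices -/

namespace Matrix

section Permanent

variable {m n R : Type*} [Fintype m] [Fintype n] [DecidableEq m] [DecidableEq n] [CommRing R]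

theorem permanent_submatrix_equiv_equiv (A : Matrix m m R) (e f : n ≃ m) :
    (A.submatrix e f).permanent = A.permanent := by
  unfold permanent
  refine Fintype.sum_equiv (Equiv.equivCongr f e) _ _ fun σ => ?_
  exact Fintype.prod_equiv f _ _ fun i => by simp [Equiv.equivCongr]

theorem permanent_fromBlocks_zero₂₁ (A : Matrix m m R) (B : Matrix m n R) (D : Matrix n n R) :
    (fromBlocks A B 0 D).permanent = A.permanent * D.permanent := by
  unfold permanent
  rw [Finset.sum_mul_sum, ← Finset.sum_product', Finset.univ_product_univ]
  symm
  refine Finset.sum_of_injOn (fun σ => Equiv.Perm.sumCongr σ.1 σ.2) ?_ (by simp) ?_ ?_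
  · exact (Equiv.Perm.sumCongrHom_injective (α := m) (β := n)).injOn
  · intro σ _ hσ
    have hmaps : ¬ Set.MapsTo σ (Set.range Sum.inl) (Set.range Sum.inl) := fun h => by
      obtain ⟨τ, hτ⟩ := Equiv.Perm.mem_sumCongrHom_range_of_perm_mapsTo_inl h
      exact hσ ⟨τ, by simp, hτ⟩
    simp only [Set.MapsTo, Set.mem_range, forall_exists_index, forall_apply_eq_imp_iff,
      not_forall, not_exists] at hmaps
    obtain ⟨a, ha⟩ := hmaps
    refine Finset.prod_eq_zero (Finset.mem_univ (Sum.inl a)) ?_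
    rcases hx : σ (Sum.inl a) with b | b
    · exact absurd hx.symm (ha b)
    · simp
  · rintro ⟨σ, τ⟩ _
    simp [Fintype.prod_sum_type]

theorem permanent_fromBlocks_zero₁₂ (A : Matrix m m R) (C : Matrix n m R) (D : Matrix n n R) :
    (fromBlocks A 0 C D).permanent = A.permanent * D.permanent := by
  rw [← permanent_transpose, fromBlocks_transpose, transpose_zero, permanent_fromBlocks_zero₂₁,
    permanent_transpose, permanent_transpose]

theorem permanent_updateCol_add (M : Matrix n n R) (j : n) (u v : n → R) :
    (M.updateCol j (u + v)).permanent =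
      (M.updateCol j u).permanent + (M.updateCol j v).permanent := by
  simp only [permanent, ← Finset.mul_prod_erase _ _ (Finset.mem_univ j), updateCol_self,
    Pi.add_apply, add_mul, Finset.sum_add_distrib]
  congr 1 <;> refine Finset.sum_congr rfl fun σ _ => congrArg _ <|
    Finset.prod_congr rfl fun i hi => ?_ <;>
  simp [updateCol_ne (Finset.ne_of_mem_erase hi)]

end Permanent

/-- The matrix `B` with an additional row and an additional column, indexed by `none`. -/
def bordered {V R : Type*} (a : R) (r c : V → R) (B : Matrix V V R) :
    Matrix (Option V) (Option V) R
  | none, none => a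
  | none, some v => r v
  | some u, none => c u
  | some u, some v => B u v

end Matrix

/-- Peel the additional point off together with the left summand. -/
def Equiv.optionSumLeft (α β : Type*) : Option (α ⊕ β) ≃ Option α ⊕ β where
  toFun
    | none => .inl none
    | some (.inl a) => .inl (some a)
    | some (.inr b) => .inr b
  invFun
    | .inl none => none
    | .inl (some a) => some (.inl a)
    | .inr b => some (.inr b)
  left_inv := by rintro (_ | _ | _) <;> rfl
  right_inv := by rintro ((_ | _) | _) <;> rfl

/-- Peel the additional point off together with the right summand. -/
def Equiv.optionSumRight (α β : Type*) : Option (α ⊕ β) ≃ α ⊕ Option β where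
  toFun
    | none => .inr none
    | some (.inl a) => .inl a
    | some (.inr b) => .inr (some b)
  invFun
    | .inl a => some (.inl a)
    | .inr none => none
    | .inr (some b) => some (.inr b)
  left_inv := by rintro (_ | _ | _) <;> rfl
  right_inv := by rintro (_ | (_ | _)) <;> rfl

/-- Exchange the additional point with the point of the summand `Option β`. -/
def Equiv.optionSumOptionSwap (α β : Type*) : Option (α ⊕ Option β) ≃ Option α ⊕ Option β where
  toFun
    | none => .inr none
    | some (.inl a) => .inl (some a)
    | some (.inr none) => .inl none
    | some (.inr (some b)) => .inr (some b)
  invFun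
    | .inl none => some (.inr none)
    | .inl (some a) => some (.inl a)
    | .inr none => none
    | .inr (some b) => some (.inr (some b))
  left_inv := by rintro (_ | _ | _ | _) <;> rfl
  right_inv := by rintro ((_ | _) | (_ | _)) <;> rfl

namespace Matrix

section Bordered

variable {V W R : Type*} [Fintype V] [Fintype W] [DecidableEq V] [DecidableEq W] [CommRing R]

theorem permanent_bordered_zero_col (a : R) (r : V → R) (B : Matrix V V R) :
    (bordered a r 0 B).permanent = a * B.permanent := by
  have h : bordered a r 0 B =
      (fromBlocks B 0 (of fun (_ : Unit) v => r v) (of fun _ _ => a)).submatrix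
        (Equiv.optionEquivSumPUnit V) (Equiv.optionEquivSumPUnit V) := by
    ext (_ | _) (_ | _) <;> rfl
  rw [h, permanent_submatrix_equiv_equiv, permanent_fromBlocks_zero₁₂, mul_comm]
  simp

theorem permanent_bordered_add_col (a : R) (r c c' : V → R) (B : Matrix V V R) :
    (bordered a r (c + c') B).permanent =
      (bordered a r c B).permanent + (bordered 0 r c' B).permanent := by
  have h (b : R) (d : V → R) : bordered b r d B =
      (bordered 0 r 0 B).updateCol none (fun u => u.elim b d) := by
    ext (_ | _) (_ | _) <;> simp [bordered]
  rw [h, h a c, h 0 c', ← permanent_updateCol_add]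
  congr 2
  ext (_ | _) <;> simp

/-- Bordering by `x` and `1` around a single diagonal entry `1`: two arcs in series. -/
theorem permanent_bordered_unit (x : R) :
    (bordered 0 (fun _ : Unit => x) 1 1).permanent = x := by
  have h : bordered 0 (fun _ : Unit => x) 1 1 =
      (fromBlocks (of fun _ _ => x : Matrix Unit Unit R) 0 1 1).submatrix
        ((Equiv.optionEquivSumPUnit Unit).trans (Equiv.sumComm _ _))
        (Equiv.optionEquivSumPUnit Unit) := by
    ext (_ | _) (_ | _) <;> rfl
  rw [h, permanent_submatrix_equiv_equiv, permanent_fromBlocks_zero₁₂]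
  simp

/-- Parallel composition. -/
theorem permanent_bordered_sum (r c : V → R) (B : Matrix V V R) (r' c' : W → R)
    (B' : Matrix W W R) :
    (bordered 0 (Sum.elim r r') (Sum.elim c c') (fromBlocks B 0 0 B')).permanent =
      (bordered 0 r c B).permanent * B'.permanent +
        B.permanent * (bordered 0 r' c' B').permanent := by
  have hc : Sum.elim c c' = Sum.elim c (0 : W → R) + Sum.elim (0 : V → R) c' := by
    ext (_ | _) <;> simp
  have h₁ : bordered 0 (Sum.elim r r') (Sum.elim c 0) (fromBlocks B 0 0 B') =
      (fromBlocks (bordered 0 r c B) (of fun u v => u.elim (r' v) 0) 0 B').submatrix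
        (Equiv.optionSumLeft V W) (Equiv.optionSumLeft V W) := by
    ext (_ | _ | _) (_ | _ | _) <;> rfl
  have h₂ : bordered 0 (Sum.elim r r') (Sum.elim 0 c') (fromBlocks B 0 0 B') =
      (fromBlocks B 0 (of fun u v => u.elim (r v) 0) (bordered 0 r' c' B')).submatrix
        (Equiv.optionSumRight V W) (Equiv.optionSumRight V W) := by
    ext (_ | _ | _) (_ | _ | _) <;> rfl
  rw [hc, permanent_bordered_add_col, h₁, h₂, permanent_submatrix_equiv_equiv,
    permanent_submatrix_equiv_equiv, permanent_fromBlocks_zero₂₁, permanent_fromBlocks_zero₁₂]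

/-- The inner part of a series composition: the border column of the first part leads to the
middle vertex, which carries a loop and whose outgoing arcs are the border row of the second. -/
def seriesInner (c : V → R) (B : Matrix V V R) (r' : W → R) (B' : Matrix W W R) :
    Matrix (V ⊕ Option W) (V ⊕ Option W) R :=
  fromBlocks B (of fun u w => w.elim (c u) 0) 0 (bordered 1 r' 0 B')

theorem permanent_seriesInner (c : V → R) (B : Matrix V V R) (r' : W → R) (B' : Matrix W W R) :
    (seriesInner c B r' B').permanent = B.permanent * B'.permanent := by
  rw [seriesInner, permanent_fromBlocks_zero₂₁, permanent_bordered_zero_col, one_mul]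

theorem permanent_bordered_seriesInner (r c : V → R) (B : Matrix V V R) (r' c' : W → R)
    (B' : Matrix W W R) :
    (bordered 0 (Sum.elim r 0) (Sum.elim 0 fun w => w.elim 0 c')
        (seriesInner c B r' B')).permanent =
      (bordered 0 r c B).permanent * (bordered 0 r' c' B').permanent := by
  have h : bordered 0 (Sum.elim r 0) (Sum.elim 0 fun w => w.elim 0 c') (seriesInner c B r' B') =
      (fromBlocks (bordered 0 r c B) 0
        (of fun u v => u.elim (v.elim 1 0) 0) (bordered 0 r' c' B')).submatrix
        (Equiv.optionSumLeft V (Option W)) (Equiv.optionSumOptionSwap V W) := by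
    ext (_ | _ | _ | _) (_ | _ | _ | _) <;> rfl
  rw [h, permanent_submatrix_equiv_equiv, permanent_fromBlocks_zero₁₂]

end Bordered

end Matrix

/-! ### Gluing rooted tree-decompositions -/

theorem SimpleGraph.IsTree.sum_sup_edge {V W : Type*} [Finite V] [Finite W] {G : SimpleGraph V}
    {H : SimpleGraph W} (hG : G.IsTree) (hH : H.IsTree) (v : V) (w : W) :
    (G.sum H ⊔ edge (.inl v) (.inr w)).IsTree := by
  rw [isTree_iff_connected_and_card] at *
  refine ⟨hG.1.sum_sup_edge hH.1, ?_⟩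
  have hne : (Sum.inl v : V ⊕ W) ≠ Sum.inr w := by simp
  rw [edgeSet_sup, edgeSet_edge_of_ne hne, Nat.card_coe_set_eq, Set.union_singleton,
    Set.ncard_insert_of_notMem (by simp), ← Nat.card_coe_set_eq, Nat.card_congr edgeSetSumEquiv,
    Nat.card_sum, Nat.card_sum]
  omega

/-- There is a finite tree of bags, with root bag `R` and set of bags `A`, in which the bags
containing any given vertex span a (possibly empty) connected subtree. -/
def HasRootedBagTree {V : Type} (R : Finset V) (A : Set (Finset V)) : Prop :=
  ∃ (ι : Type) (_ : Finite ι) (T : SimpleGraph ι) (X : ι → Finset V) (o : ι),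
    T.IsTree ∧ X o = R ∧ Set.range X = A ∧
    ∀ v i j, v ∈ X i → v ∈ X j →
      Relation.ReflTransGen (fun a b => T.Adj a b ∧ v ∈ X a ∧ v ∈ X b) i j

namespace HasRootedBagTree

variable {V : Type} {R S : Finset V} {A B : Set (Finset V)}

theorem single (R : Finset V) : HasRootedBagTree R {R} :=
  ⟨Unit, inferInstance, ⊥, fun _ => R, (), .of_subsingleton, rfl, by simp,
    fun _ _ _ _ _ => .refl⟩

theorem root_mem (h : HasRootedBagTree R A) : R ∈ A := by
  obtain ⟨ι, _, T, X, o, -, rfl, rfl, -⟩ := h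
  exact ⟨o, rfl⟩

theorem glue (hR : HasRootedBagTree R A) (hS : HasRootedBagTree S B)
    (h : ∀ X ∈ A, ∀ Y ∈ B, ∀ v ∈ X, v ∈ Y → v ∈ R ∧ v ∈ S) :
    HasRootedBagTree R (A ∪ B) := by
  obtain ⟨ι, _, T, X, o, hT, rfl, rfl, hX⟩ := hR
  obtain ⟨κ, _, U, Y, p, hU, rfl, rfl, hY⟩ := hS
  have left (v i j) (hi : v ∈ X i) (hj : v ∈ X j) := (hX v i j hi hj).lift
    (p := fun a b => (T.sum U ⊔ SimpleGraph.edge (.inl o) (.inr p)).Adj a b ∧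
      v ∈ Sum.elim X Y a ∧ v ∈ Sum.elim X Y b) Sum.inl fun a b hab => by simpa using
        ⟨Or.inl hab.1, hab.2⟩
  have right (v i j) (hi : v ∈ Y i) (hj : v ∈ Y j) := (hY v i j hi hj).lift
    (p := fun a b => (T.sum U ⊔ SimpleGraph.edge (.inl o) (.inr p)).Adj a b ∧
      v ∈ Sum.elim X Y a ∧ v ∈ Sum.elim X Y b) Sum.inr fun a b hab => by simpa using
        ⟨Or.inl hab.1, hab.2⟩
  refine ⟨ι ⊕ κ, inferInstance, _, Sum.elim X Y, .inl o, hT.sum_sup_edge hU o p, rfl,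
    Set.Sum.elim_range X Y, ?_⟩
  rintro v (i | i) (j | j) hi hj
  · exact left v i j hi hj
  · obtain ⟨ho, hp⟩ := h _ ⟨i, rfl⟩ _ ⟨j, rfl⟩ v hi hj
    exact (left v i o hi ho).trans (.head (b := Sum.inr p) ⟨by simp [SimpleGraph.edge_adj], ho, by exact hp⟩
      (right v p j hp hj))
  · obtain ⟨ho, hp⟩ := h _ ⟨j, rfl⟩ _ ⟨i, rfl⟩ v hj hi
    exact (right v i p hi hp).trans (.head (b := Sum.inl o) ⟨by simp [SimpleGraph.edge_adj], hp, by exact ho⟩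
      (left v o j ho hj))
  · exact right v i j hi hj

theorem hasTreewidthAtMost {G : SimpleGraph V} {k : ℕ} (h : HasRootedBagTree R A)
    (hcard : ∀ X ∈ A, X.card ≤ k + 1) (hvert : ∀ v, ∃ X ∈ A, v ∈ X)
    (hedge : ∀ u v, G.Adj u v → ∃ X ∈ A, u ∈ X ∧ v ∈ X) : HasTreewidthAtMost G k := by
  obtain ⟨ι, _, T, X, o, hT, rfl, rfl, hX⟩ := h
  obtain ⟨n, ⟨e⟩⟩ := Finite.exists_equiv_fin ι
  simp only [Set.exists_range_iff, Set.forall_mem_range] at hcard hvert hedge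
  refine ⟨n, T.comap e.symm, X ∘ e.symm, (SimpleGraph.Iso.comap e.symm T).isTree_iff.2 hT,
    fun t => hcard _, fun v => ?_, fun u v huv => ?_, fun v => ?_⟩
  · obtain ⟨i, hi⟩ := hvert v
    exact ⟨e i, by simpa⟩
  · obtain ⟨i, hi⟩ := hedge u v huv
    exact ⟨e i, by simpa⟩
  · obtain ⟨i, hi⟩ := hvert v
    have : Nonempty {t | v ∈ (X ∘ e.symm) t} := ⟨⟨e i, by simpa⟩⟩
    refine ⟨?_⟩
    rintro ⟨a, ha⟩ ⟨b, hb⟩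
    have key (c) (hc : v ∈ X c) (hac : Relation.ReflTransGen
        (fun a b => T.Adj a b ∧ v ∈ X a ∧ v ∈ X b) (e.symm a) c) :
        ((T.comap e.symm).induce {t | v ∈ (X ∘ e.symm) t}).Reachable ⟨a, ha⟩
          ⟨e c, by simpa⟩ := by
      induction hac with
      | refl => simp
      | tail _ hbc ih =>
        exact (ih hbc.2.1).trans (SimpleGraph.Adj.reachable (by simpa using hbc.1))
    simpa using key _ hb (hX v _ _ ha hb)

end HasRootedBagTree

/-- Bags of size at most three, among them a root bag containing the terminals `s` and `t`,
that decompose the image under `e` of the two-terminal graph with inner arcs `B`, arcs `r` out of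
`s` and arcs `c` into `t`. -/
def TwoTerminalDecomposable {V P W : Type} [Zero P] (r c : V → P) (B : Matrix V V P)
    (e : V → W) (s t : W) : Prop :=
  ∃ R A, HasRootedBagTree R A ∧ s ∈ R ∧ t ∈ R ∧ (∀ X ∈ A, X.card ≤ 3) ∧
    (∀ X ∈ A, ∀ w ∈ X, w = s ∨ w = t ∨ w ∈ Set.range e) ∧
    (∀ v, ∃ X ∈ A, e v ∈ X) ∧
    (∀ v, r v ≠ 0 → ∃ X ∈ A, s ∈ X ∧ e v ∈ X) ∧
    (∀ v, c v ≠ 0 → ∃ X ∈ A, e v ∈ X ∧ t ∈ X) ∧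
    (∀ u v, B u v ≠ 0 → u = v ∨ ∃ X ∈ A, e u ∈ X ∧ e v ∈ X)

namespace TwoTerminalDecomposable

variable {P V₁ V₂ W : Type} [CommRing P] {r₁ c₁ : V₁ → P} {B₁ : Matrix V₁ V₁ P}
  {r₂ c₂ : V₂ → P} {B₂ : Matrix V₂ V₂ P} {s t : W}

theorem of_unit (r c : Unit → P) (B : Matrix Unit Unit P) (e : Unit → W) :
    TwoTerminalDecomposable r c B e s t :=
  ⟨{s, t, e ()}, _, .single _, by simp, by simp, by simpa using Finset.card_le_three,
    by simp, by simp, by simp, by simp, by simp⟩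

theorem parallel {e : V₁ ⊕ V₂ → W} (he : e.Injective) (hs : s ∉ Set.range e)
    (ht : t ∉ Set.range e)
    (h₁ : TwoTerminalDecomposable r₁ c₁ B₁ (e ∘ Sum.inl) s t)
    (h₂ : TwoTerminalDecomposable r₂ c₂ B₂ (e ∘ Sum.inr) s t) :
    TwoTerminalDecomposable (Sum.elim r₁ r₂) (Sum.elim c₁ c₂) (Matrix.fromBlocks B₁ 0 0 B₂)
      e s t := by
  obtain ⟨R₁, A₁, T₁, s₁, t₁, k₁, u₁, v₁, a₁, b₁, d₁⟩ := h₁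
  obtain ⟨R₂, A₂, T₂, s₂, t₂, k₂, u₂, v₂, a₂, b₂, d₂⟩ := h₂
  refine ⟨R₁, A₁ ∪ A₂, T₁.glue T₂ ?_, s₁, t₁, ?_, ?_, ?_, ?_, ?_, ?_⟩
  · intro X hX Y hY v hvX hvY
    rcases u₁ X hX v hvX with rfl | rfl | ⟨a, rfl⟩
    · exact ⟨s₁, s₂⟩
    · exact ⟨t₁, t₂⟩
    · rcases u₂ Y hY _ hvY with h | h | ⟨b, h⟩
      · exact absurd ⟨_, h⟩ hs
      · exact absurd ⟨_, h⟩ ht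
      · exact absurd (he h) (by simp)
  · rintro X (hX | hX)
    exacts [k₁ X hX, k₂ X hX]
  · rintro X (hX | hX) w hw
    · exact (u₁ X hX w hw).imp_right (.imp_right fun ⟨v, hv⟩ => ⟨_, hv⟩)
    · exact (u₂ X hX w hw).imp_right (.imp_right fun ⟨v, hv⟩ => ⟨_, hv⟩)
  · rintro (v | v)
    · exact (v₁ v).imp fun X h => ⟨.inl h.1, h.2⟩
    · exact (v₂ v).imp fun X h => ⟨.inr h.1, h.2⟩
  · rintro (v | v) hv
    · exact (a₁ v hv).imp fun X h => ⟨.inl h.1, h.2⟩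
    · exact (a₂ v hv).imp fun X h => ⟨.inr h.1, h.2⟩
  · rintro (v | v) hv
    · exact (b₁ v hv).imp fun X h => ⟨.inl h.1, h.2⟩
    · exact (b₂ v hv).imp fun X h => ⟨.inr h.1, h.2⟩
  · rintro (u | u) (v | v) huv
    · exact (d₁ u v huv).imp (congrArg _) (.imp fun X h => ⟨.inl h.1, h.2⟩)
    · exact absurd rfl huv
    · exact absurd rfl huv
    · exact (d₂ u v huv).imp (congrArg _) (.imp fun X h => ⟨.inr h.1, h.2⟩)

theorem series {e : V₁ ⊕ Option V₂ → W} (he : e.Injective) (hs : s ∉ Set.range e)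
    (ht : t ∉ Set.range e)
    (h₁ : TwoTerminalDecomposable r₁ c₁ B₁ (e ∘ Sum.inl) s (e (.inr none)))
    (h₂ : TwoTerminalDecomposable r₂ c₂ B₂ (e ∘ Sum.inr ∘ some) (e (.inr none)) t) :
    TwoTerminalDecomposable (Sum.elim r₁ 0) (Sum.elim 0 fun w => w.elim 0 c₂)
      (Matrix.seriesInner c₁ B₁ r₂ B₂) e s t := by
  obtain ⟨R₁, A₁, T₁, s₁, t₁, k₁, u₁, v₁, a₁, b₁, d₁⟩ := h₁
  obtain ⟨R₂, A₂, T₂, s₂, t₂, k₂, u₂, v₂, a₂, b₂, d₂⟩ := h₂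
  have T := ((HasRootedBagTree.single {s, t, e (.inr none)}).glue T₁ (by
    rintro X rfl Y hY v hvX hvY
    refine ⟨hvX, ?_⟩
    simp only [Finset.mem_insert, Finset.mem_singleton] at hvX
    rcases hvX with rfl | rfl | rfl
    · exact s₁
    · rcases u₁ Y hY _ hvY with h | h | ⟨a, h⟩
      · exact h ▸ s₁
      · exact h ▸ t₁
      · exact absurd ⟨_, h⟩ ht
    · exact t₁)).glue T₂ (by
    intro X hX Y hY v hvX hvY
    have hv : v ∈ ({s, t, e (.inr none)} : Finset W) := by
      rcases hX with rfl | hX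
      · exact hvX
      · rcases u₁ X hX v hvX with rfl | rfl | ⟨a, rfl⟩
        · simp
        · simp
        · rcases u₂ Y hY _ hvY with h | h | ⟨b, h⟩
          · exact absurd (he h) (by simp)
          · exact absurd ⟨_, h⟩ ht
          · exact absurd (he h) (by simp)
    refine ⟨hv, ?_⟩
    rcases u₂ Y hY v hvY with rfl | rfl | ⟨b, rfl⟩
    · exact s₂
    · exact t₂
    · simp only [Finset.mem_insert, Finset.mem_singleton] at hv
      rcases hv with h | h | h
      · exact absurd ⟨_, h⟩ hs
      · exact absurd ⟨_, h⟩ ht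
      · exact absurd (he h) (by simp))
  refine ⟨_, _, T, by simp, by simp, ?_, ?_, ?_, ?_, ?_, ?_⟩
  · rintro X ((rfl | hX) | hX)
    exacts [Finset.card_le_three, k₁ X hX, k₂ X hX]
  · rintro X ((rfl | hX) | hX) w hw
    · simp only [Finset.mem_insert, Finset.mem_singleton] at hw
      exact hw.imp_right (.imp_right fun h => ⟨_, h.symm⟩)
    · rcases u₁ X hX w hw with h | h | ⟨v, h⟩
      exacts [.inl h, .inr (.inr ⟨_, h.symm⟩), .inr (.inr ⟨_, h⟩)]
    · rcases u₂ X hX w hw with h | h | ⟨v, h⟩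
      exacts [.inr (.inr ⟨_, h.symm⟩), .inr (.inl h), .inr (.inr ⟨_, h⟩)]
  · rintro (v | _ | v)
    · exact (v₁ v).imp fun X h => ⟨.inl (.inr h.1), h.2⟩
    · exact ⟨_, .inl (.inl rfl), by simp⟩
    · exact (v₂ v).imp fun X h => ⟨.inr h.1, h.2⟩
  · rintro (v | v) hv
    · exact (a₁ v hv).imp fun X h => ⟨.inl (.inr h.1), h.2⟩
    · exact absurd rfl hv
  · rintro (v | _ | v) hv
    · exact absurd rfl hv
    · exact absurd rfl hv
    · exact (b₂ v hv).imp fun X h => ⟨.inr h.1, h.2⟩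
  · rintro (u | _ | u) (v | _ | v) huv
    · exact (d₁ u v huv).imp (congrArg _) (.imp fun X h => ⟨.inl (.inr h.1), h.2⟩)
    · exact .inr ((b₁ u huv).imp fun X h => ⟨.inl (.inr h.1), h.2⟩)
    · exact absurd rfl huv
    · exact absurd rfl huv
    · exact .inl rfl
    · exact .inr ((a₂ v huv).imp fun X h => ⟨.inr h.1, h.2⟩)
    · exact absurd rfl huv
    · exact absurd rfl huv
    · exact (d₂ u v huv).imp (congrArg (Sum.inr ∘ some)) (.imp fun X h => ⟨.inr h.1, h.2⟩)

end TwoTerminalDecomposable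

/-! ### From formulas to two-terminal graphs -/

/-- `r`, `c`, `B` are the arcs out of the source, into the sink and between inner vertices (loops
included) of a two-terminal graph of treewidth two, weighted by elements of `E`, whose permanent
after identification of the terminals is `p`. -/
structure IsTwoTerminalGraph {V P : Type} [Fintype V] [CommRing P] (E : Set P) (p : P)
    (r c : V → P) (B : Matrix V V P) : Prop where
  row_mem : ∀ v, r v ∈ E
  col_mem : ∀ v, c v ∈ E
  inner_mem : ∀ u v, B u v ∈ E
  permanent_inner : B.permanent = 1
  permanent_bordered : (Matrix.bordered 0 r c B).permanent = p
  decomposable : ∀ {W : Type} (e : V → W) (s t : W), e.Injective → s ∉ Set.range e →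
    t ∉ Set.range e → TwoTerminalDecomposable r c B e s t

namespace IsTwoTerminalGraph

variable {P V₁ V₂ : Type} [Fintype V₁] [Fintype V₂] [CommRing P] {E E₁ E₂ : Set P} {p₁ p₂ : P}
  {r₁ c₁ : V₁ → P} {B₁ : Matrix V₁ V₁ P} {r₂ c₂ : V₂ → P} {B₂ : Matrix V₂ V₂ P}

theorem arc (h1 : 1 ∈ E) {x : P} (hx : x ∈ E) :
    IsTwoTerminalGraph (V := Unit) E x (fun _ => x) 1 1 where
  row_mem _ := hx
  col_mem _ := h1
  inner_mem _ _ := by simpa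
  permanent_inner := Matrix.permanent_one
  permanent_bordered := by convert Matrix.permanent_bordered_unit x
  decomposable e _ _ _ _ _ := .of_unit _ _ _ e

theorem mono (h : IsTwoTerminalGraph E₁ p₁ r₁ c₁ B₁) (hE : E₁ ⊆ E) :
    IsTwoTerminalGraph E p₁ r₁ c₁ B₁ :=
  { h with
    row_mem := fun v => hE (h.row_mem v)
    col_mem := fun v => hE (h.col_mem v)
    inner_mem := fun u v => hE (h.inner_mem u v) }

theorem parallel (h0 : 0 ∈ E) (h₁ : IsTwoTerminalGraph E p₁ r₁ c₁ B₁)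
    (h₂ : IsTwoTerminalGraph E p₂ r₂ c₂ B₂) :
    IsTwoTerminalGraph E (p₁ + p₂) (Sum.elim r₁ r₂) (Sum.elim c₁ c₂)
      (Matrix.fromBlocks B₁ 0 0 B₂) where
  row_mem := Sum.forall.2 ⟨h₁.row_mem, h₂.row_mem⟩
  col_mem := Sum.forall.2 ⟨h₁.col_mem, h₂.col_mem⟩
  inner_mem := by
    rintro (u | u) (v | v)
    exacts [h₁.inner_mem u v, h0, h0, h₂.inner_mem u v]
  permanent_inner := by
    convert Matrix.permanent_fromBlocks_zero₂₁ B₁ 0 B₂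
    rw [h₁.permanent_inner, h₂.permanent_inner, one_mul]
  permanent_bordered := by
    have := Matrix.permanent_bordered_sum r₁ c₁ B₁ r₂ c₂ B₂
    rw [h₁.permanent_inner, h₂.permanent_inner, one_mul, mul_one] at this
    rw [← h₁.permanent_bordered, ← h₂.permanent_bordered]
    convert this
  decomposable e s t he hs ht := .parallel he hs ht
    (h₁.decomposable _ s t (he.comp Sum.inl_injective) (fun ⟨v, hv⟩ => hs ⟨_, hv⟩)
      fun ⟨v, hv⟩ => ht ⟨_, hv⟩)
    (h₂.decomposable _ s t (he.comp Sum.inr_injective) (fun ⟨v, hv⟩ => hs ⟨_, hv⟩)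
      fun ⟨v, hv⟩ => ht ⟨_, hv⟩)

theorem series (h0 : 0 ∈ E) (h1 : 1 ∈ E) (h₁ : IsTwoTerminalGraph E p₁ r₁ c₁ B₁)
    (h₂ : IsTwoTerminalGraph E p₂ r₂ c₂ B₂) :
    IsTwoTerminalGraph E (p₁ * p₂) (Sum.elim r₁ 0) (Sum.elim 0 fun w => w.elim 0 c₂)
      (Matrix.seriesInner c₁ B₁ r₂ B₂) where
  row_mem := Sum.forall.2 ⟨h₁.row_mem, fun _ => h0⟩
  col_mem := Sum.forall.2 ⟨fun _ => h0, Option.forall.2 ⟨h0, h₂.col_mem⟩⟩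
  inner_mem := by
    rintro (u | _ | u) (v | _ | v)
    exacts [h₁.inner_mem u v, h₁.col_mem u, h0, h0, h1, h₂.row_mem v, h0, h0, h₂.inner_mem u v]
  permanent_inner := by
    convert Matrix.permanent_seriesInner c₁ B₁ r₂ B₂
    rw [h₁.permanent_inner, h₂.permanent_inner, one_mul]
  permanent_bordered := by
    rw [← h₁.permanent_bordered, ← h₂.permanent_bordered]
    convert Matrix.permanent_bordered_seriesInner r₁ c₁ B₁ r₂ c₂ B₂
  decomposable e s t he hs ht := .series he hs ht
    (h₁.decomposable _ _ _ (he.comp Sum.inl_injective) (fun ⟨v, hv⟩ => hs ⟨_, hv⟩)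
      fun ⟨v, hv⟩ => by simpa using he hv)
    (h₂.decomposable _ _ _ (he.comp (Sum.inr_injective.comp (Option.some_injective _)))
      (fun ⟨v, hv⟩ => by simpa using he hv) fun ⟨v, hv⟩ => ht ⟨_, hv⟩)

end IsTwoTerminalGraph

/-- The entries allowed for a formula: zero, one and its variables. -/
def Formula.entries {K ν : Type} [CommRing K] (φ : Formula K ν) : Set (MvPolynomial ν K) :=
  {0, 1} ∪ MvPolynomial.X '' φ.varSet

theorem Formula.zero_mem_entries {K ν : Type} [CommRing K] (φ : Formula K ν) : 0 ∈ φ.entries :=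
  .inl (.inl rfl)

theorem Formula.one_mem_entries {K ν : Type} [CommRing K] (φ : Formula K ν) : 1 ∈ φ.entries :=
  .inl (.inr rfl)

theorem Formula.exists_isTwoTerminalGraph {K ν : Type} [CommRing K] (φ : Formula K ν)
    (hφ : φ.ZeroOneConsts) :
    ∃ (V : Type) (_ : Fintype V) (r c : V → MvPolynomial ν K)
      (B : Matrix V V (MvPolynomial ν K)),
      Fintype.card V ≤ φ.size ∧ IsTwoTerminalGraph φ.entries φ.toPoly r c B := by
  induction φ with
  | const a =>
    refine ⟨Unit, inferInstance, _, _, _, by simp [size], .arc (one_mem_entries _) ?_⟩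
    rcases hφ with rfl | rfl
    · simpa [toPoly] using zero_mem_entries _
    · simpa [toPoly] using one_mem_entries _
  | var v =>
    exact ⟨Unit, inferInstance, _, _, _, by simp [size],
      .arc (one_mem_entries _) (.inr ⟨v, rfl, rfl⟩)⟩
  | add f g ihf ihg =>
    obtain ⟨V, _, r, c, B, hV, h⟩ := ihf hφ.1
    obtain ⟨V', _, r', c', B', hV', h'⟩ := ihg hφ.2
    exact ⟨V ⊕ V', inferInstance, _, _, _, by simp [size]; omega,
      .parallel (zero_mem_entries _)
        (h.mono (Set.union_subset_union_right _ (Set.image_mono Set.subset_union_left)))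
        (h'.mono (Set.union_subset_union_right _ (Set.image_mono Set.subset_union_right)))⟩
  | mul f g ihf ihg =>
    obtain ⟨V, _, r, c, B, hV, h⟩ := ihf hφ.1
    obtain ⟨V', _, r', c', B', hV', h'⟩ := ihg hφ.2
    exact ⟨V ⊕ Option V', inferInstance, _, _, _, by simp [size]; omega,
      .series (zero_mem_entries _) (one_mem_entries _)
        (h.mono (Set.union_subset_union_right _ (Set.image_mono Set.subset_union_left)))
        (h'.mono (Set.union_subset_union_right _ (Set.image_mono Set.subset_union_right)))⟩

theorem perm_eq_permanent {m : ℕ} {R : Type} [CommRing R] (M : Matrix (Fin m) (Fin m) R) :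
    perm M = M.permanent := by
  rw [← Matrix.permanent_transpose]
  rfl

/-- every arithmetic formula of size `n` (inputs: variables and constants
0, 1) can be expressed as the permanent of a matrix of size at most `(n+1)×(n+1)` and
treewidth at most 2 whose entries are 0, 1, or variables of the formula. -/
theorem formula_as_bounded_treewidth_permanent {K ν : Type} [Field K]
    (φ : Formula K ν) (hφ : φ.ZeroOneConsts) :
    ∃ m : ℕ, m ≤ φ.size + 1 ∧
      ∃ M : Matrix (Fin m) (Fin m) (MvPolynomial ν K),
        (∀ i j, M i j = 0 ∨ M i j = 1 ∨ ∃ v ∈ φ.varSet, M i j = MvPolynomial.X v) ∧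
        HasTreewidthAtMost (supportGraph M) 2 ∧
        perm M = φ.toPoly := by
  obtain ⟨V, _, r, c, B, hV, h⟩ := φ.exists_isTwoTerminalGraph hφ
  obtain ⟨e⟩ : Nonempty (Fin (Fintype.card (Option V)) ≃ Option V) :=
    ⟨(Fintype.equivFin (Option V)).symm⟩
  refine ⟨_, by simpa using hV, (Matrix.bordered 0 r c B).submatrix e e, ?_, ?_, ?_⟩
  · have hentries (a b) : Matrix.bordered 0 r c B a b ∈ φ.entries := by
      rcases a with _ | a <;> rcases b with _ | b
      exacts [φ.zero_mem_entries, h.row_mem b, h.col_mem a, h.inner_mem a b]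
    intro i j
    rcases hentries (e i) (e j) with (h | h) | ⟨v, hv, h⟩
    exacts [.inl h, .inr (.inl h), .inr (.inr ⟨v, hv, h.symm⟩)]
  · obtain ⟨R, A, hA, hs, -, hcard, -, hvert, hr, hc, hB⟩ := h.decomposable (e.symm ∘ some)
      (e.symm none) (e.symm none) (e.symm.injective.comp (Option.some_injective _))
      (by simp) (by simp)
    have harc (a b) (hab : Matrix.bordered 0 r c B a b ≠ 0) :
        a = b ∨ ∃ X ∈ A, e.symm a ∈ X ∧ e.symm b ∈ X := by
      rcases a with _ | a <;> rcases b with _ | b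
      exacts [.inl rfl, .inr (hr b hab), .inr (hc a hab), (hB a b hab).imp_left (congrArg _)]
    refine hA.hasTreewidthAtMost hcard (fun i => ?_) fun i j hij => ?_
    · obtain ⟨a, rfl⟩ := e.symm.surjective i
      rcases a with _ | a
      exacts [⟨R, hA.root_mem, hs⟩, hvert a]
    · obtain ⟨hne, hij | hij⟩ := hij
      · simpa [hne] using harc _ _ hij
      · simpa [hne.symm, and_comm] using harc _ _ hij
  · rw [perm_eq_permanent, ← h.permanent_bordered]
    convert Matrix.permanent_submatrix_equiv_equiv _ e e
end

section
/- Every polynomial computed by an arithmetic formula of size n over a field K can be expressed as the hamiltonian polynomial of a matrix of size at most (2n+1)×(2n+1) and treewidth at most 6, whose entries are 0, 1, or variables of the formula. -/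
open scoped Classical

namespace Formula
variable {K ν : Type}

/-- The number of internal vertices of the series-parallel digraph of a formula. -/
def innerCount : Formula K ν → ℕ
  | const _ => 1
  | var _ => 1
  | add f g => f.innerCount + g.innerCount
  | mul f g => f.innerCount + g.innerCount + 1

theorem innerCount_pos (φ : Formula K ν) : 0 < φ.innerCount := by
  induction φ <;> simp only [innerCount] <;> omega

theorem innerCount_le_size (φ : Formula K ν) : φ.innerCount ≤ φ.size := by
  induction φ <;> simp only [innerCount, size] <;> omega

/-- The two-edge path from `s` to `t` through `a + 1` whose first edge has weight `x`. -/
def leafWeight {R : Type} [CommRing R] (x : R) (a s t i j : ℕ) : R :=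
  (if i = s ∧ j = a + 1 then x else 0) + (if i = a + 1 ∧ j = t then 1 else 0)

/-- The weighted series-parallel digraph of a formula with source `s` and sink `t`, whose internal
vertices are the odd numbers between `a` and `a + 2 * φ.innerCount`. -/
noncomputable def weight [CommRing K] : Formula K ν → ℕ → ℕ → ℕ → ℕ → ℕ → MvPolynomial ν K
  | const c, a, s, t, i, j => leafWeight (MvPolynomial.C c) a s t i j
  | var v, a, s, t, i, j => leafWeight (MvPolynomial.X v) a s t i j
  | add f g, a, s, t, i, j => f.weight a s t i j + g.weight (a + 2 * f.innerCount) s t i j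
  | mul f g, a, s, t, i, j =>
      f.weight a s (a + 2 * f.innerCount + 1) i j +
        g.weight (a + 2 * f.innerCount + 2) (a + 2 * f.innerCount + 1) t i j

/-- `i` is an internal vertex of the digraph of a formula placed between `a` and `b`. -/
def Inner (a b i : ℕ) : Prop := i % 2 = 1 ∧ a < i ∧ i < b

theorem leafWeight_ne_zero {R : Type} [CommRing R] {x : R} {a s t i j : ℕ} (ha : a % 2 = 0)
    (h : leafWeight x a s t i j ≠ 0) :
    (i = s ∧ Inner a (a + 2) j) ∨ (Inner a (a + 2) i ∧ j = t) := by
  unfold leafWeight at h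
  unfold Inner
  by_cases h1 : i = s ∧ j = a + 1
  · left; omega
  · by_cases h2 : i = a + 1 ∧ j = t
    · right; omega
    · simp [h1, h2] at h

theorem leafWeight_cases {R : Type} [CommRing R] (x : R) {a s t : ℕ}
    (hs : ¬ (a < s ∧ s < a + 2)) (i j : ℕ) :
    leafWeight x a s t i j = 0 ∨ leafWeight x a s t i j = 1 ∨ leafWeight x a s t i j = x := by
  unfold leafWeight
  by_cases h1 : i = s ∧ j = a + 1
  · rw [if_pos h1, if_neg (by omega), add_zero]
    exact Or.inr (Or.inr rfl)
  · rw [if_neg h1, zero_add]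
    by_cases h2 : i = a + 1 ∧ j = t
    · exact Or.inr (Or.inl (if_pos h2))
    · exact Or.inl (if_neg h2)

theorem weight_ne_zero [CommRing K] (φ : Formula K ν) :
    ∀ {a s t i j : ℕ}, a % 2 = 0 → φ.weight a s t i j ≠ 0 →
      (i = s ∧ Inner a (a + 2 * φ.innerCount) j) ∨
      (Inner a (a + 2 * φ.innerCount) i ∧ j = t) ∨
      (Inner a (a + 2 * φ.innerCount) i ∧ Inner a (a + 2 * φ.innerCount) j ∧ i < j) := by
  induction φ with
  | const c => intro a s t i j ha h; have := leafWeight_ne_zero ha h; simp only [innerCount]; tauto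
  | var c => intro a s t i j ha h; have := leafWeight_ne_zero ha h; simp only [innerCount]; tauto
  | add f g hf hg =>
    intro a s t i j ha h
    simp only [innerCount]
    simp only [weight] at h
    by_cases h1 : f.weight a s t i j = 0
    · rw [h1, zero_add] at h
      have := hg (by omega) h
      unfold Inner at *
      omega
    · have := hf ha h1
      unfold Inner at *
      omega
  | mul f g hf hg =>
    intro a s t i j ha h
    simp only [innerCount]
    simp only [weight] at h
    by_cases h1 : f.weight a s (a + 2 * f.innerCount + 1) i j = 0
    · rw [h1, zero_add] at h
      have := hg (by omega) h
      unfold Inner at *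
      omega
    · have := hf ha h1
      unfold Inner at *
      omega

/-- A row outside the source and the internal vertices vanishes. -/
theorem weight_eq_zero_of_row [CommRing K] (φ : Formula K ν) {a s t i : ℕ} (ha : a % 2 = 0)
    (h1 : i ≠ s) (h2 : ¬ Inner a (a + 2 * φ.innerCount) i) (j : ℕ) : φ.weight a s t i j = 0 := by
  by_contra h
  have := φ.weight_ne_zero ha h
  tauto

theorem weight_mem [Field K] (φ : Formula K ν) (hφ : φ.ZeroOneConsts) :
    ∀ {a s t : ℕ}, a % 2 = 0 → ¬ (a < s ∧ s < a + 2 * φ.innerCount) →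
      ¬ (a < t ∧ t < a + 2 * φ.innerCount) → ∀ i j : ℕ,
      φ.weight a s t i j = 0 ∨ φ.weight a s t i j = 1 ∨
        ∃ v ∈ φ.varSet, φ.weight a s t i j = MvPolynomial.X v := by
  induction φ with
  | const c =>
    intro a s t ha hs ht i j
    simp only [weight]
    rcases leafWeight_cases (MvPolynomial.C c : MvPolynomial ν K) hs i j with h | h | h
    · exact Or.inl h
    · exact Or.inr (Or.inl h)
    · rw [h]
      rcases hφ with rfl | rfl <;> simp
  | var v =>
    intro a s t ha hs ht i j
    simp only [weight]
    rcases leafWeight_cases (MvPolynomial.X v : MvPolynomial ν K) hs i j with h | h | h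
    · exact Or.inl h
    · exact Or.inr (Or.inl h)
    · exact Or.inr (Or.inr ⟨v, rfl, h⟩)
  | add f g hf hg =>
    intro a s t ha hs ht i j
    simp only [innerCount] at hs ht
    simp only [weight, varSet]
    by_cases h1 : f.weight a s t i j = 0
    · rw [h1, zero_add]
      rcases hg hφ.2 (a := a + 2 * f.innerCount) (s := s) (t := t) (by omega) (by omega)
        (by omega) i j with h | h | ⟨v, hv, h⟩
      · exact Or.inl h
      · exact Or.inr (Or.inl h)
      · exact Or.inr (Or.inr ⟨v, Or.inr hv, h⟩)
    · have h2 : g.weight (a + 2 * f.innerCount) s t i j = 0 := by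
        by_contra h2
        have h3 := f.weight_ne_zero ha h1
        have h4 := g.weight_ne_zero (by omega) h2
        unfold Inner at *
        omega
      rw [h2, add_zero]
      rcases hf hφ.1 (a := a) (s := s) (t := t) (by omega) (by omega)
        (by omega) i j with h | h | ⟨v, hv, h⟩
      · exact Or.inl h
      · exact Or.inr (Or.inl h)
      · exact Or.inr (Or.inr ⟨v, Or.inl hv, h⟩)
  | mul f g hf hg =>
    intro a s t ha hs ht i j
    simp only [innerCount] at hs ht
    simp only [weight, varSet]
    by_cases h1 : f.weight a s (a + 2 * f.innerCount + 1) i j = 0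
    · rw [h1, zero_add]
      rcases hg hφ.2 (a := a + 2 * f.innerCount + 2) (s := a + 2 * f.innerCount + 1) (t := t)
        (by omega) (by omega) (by omega) i j with h | h | ⟨v, hv, h⟩
      · exact Or.inl h
      · exact Or.inr (Or.inl h)
      · exact Or.inr (Or.inr ⟨v, Or.inr hv, h⟩)
    · have h2 : g.weight (a + 2 * f.innerCount + 2) (a + 2 * f.innerCount + 1) t i j = 0 := by
        by_contra h2
        have h3 := f.weight_ne_zero ha h1
        have h4 := g.weight_ne_zero (by omega) h2
        unfold Inner at *
        omega
      rw [h2, add_zero]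
      rcases hf hφ.1 (a := a) (s := s) (t := a + 2 * f.innerCount + 1) (by omega) (by omega)
        (by omega) i j with h | h | ⟨v, hv, h⟩
      · exact Or.inl h
      · exact Or.inr (Or.inl h)
      · exact Or.inr (Or.inr ⟨v, Or.inl hv, h⟩)

theorem exists_pathSum_leaf {R : Type} [CommRing R] (x : R) {a s t : ℕ} (ha : a % 2 = 0)
    (hs : ¬ (a < s ∧ s < a + 2)) :
    ∃ P : ℕ → R, (∀ i, P i ≠ 0 → Inner a (a + 2) i) ∧
      ∀ N, a + 2 ≤ N → ∀ j,
        ∑ i ∈ Finset.range N, P i * leafWeight x a s t i j + leafWeight x a s t s j =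
          P j + if j = t then x else 0 := by
  refine ⟨fun i => if i = a + 1 then x else 0, fun i hi => ?_, fun N hN j => ?_⟩
  · have : i = a + 1 := by by_contra h; simp [h] at hi
    unfold Inner
    omega
  · have h1 : a + 1 ∈ Finset.range N := by simp; omega
    have h2 : a + 1 ≠ s := by omega
    simp only [ite_mul, zero_mul]
    rw [Finset.sum_ite_eq' (Finset.range N) (a + 1), if_pos h1]
    simp only [leafWeight, h2, h2.symm]
    simp
    ring

/-- The path sums `P` from the source to the internal vertices: they satisfy the path recursion,
and the recursion at the sink gives the polynomial of the formula. -/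
theorem exists_pathSum [CommRing K] (φ : Formula K ν) :
    ∀ {a s t : ℕ}, a % 2 = 0 → ¬ (a < s ∧ s < a + 2 * φ.innerCount) →
      ¬ (a < t ∧ t < a + 2 * φ.innerCount) →
      ∃ P : ℕ → MvPolynomial ν K, (∀ i, P i ≠ 0 → Inner a (a + 2 * φ.innerCount) i) ∧
        ∀ N, a + 2 * φ.innerCount ≤ N → ∀ j,
          ∑ i ∈ Finset.range N, P i * φ.weight a s t i j + φ.weight a s t s j =
            P j + if j = t then φ.toPoly else 0 := by
  induction φ with
  | const c => intro a s t ha hs _; exact exists_pathSum_leaf _ ha hs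
  | var c => intro a s t ha hs _; exact exists_pathSum_leaf _ ha hs
  | add f g hf hg =>
    intro a s t ha hs ht
    simp only [innerCount] at hs ht
    obtain ⟨P, hP, hP'⟩ := hf (a := a) (s := s) (t := t) ha (by omega) (by omega)
    obtain ⟨Q, hQ, hQ'⟩ := hg (a := a + 2 * f.innerCount) (s := s) (t := t)
      (by omega) (by omega) (by omega)
    refine ⟨fun i => P i + Q i, fun i hi => ?_, fun N hN j => ?_⟩
    · simp only [innerCount]
      by_cases h : P i = 0
      · have := hQ i (by simpa [h] using hi)
        unfold Inner at *
        omega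
      · have := hP i h
        unfold Inner at *
        omega
    · simp only [innerCount] at hN
      simp only [weight, toPoly]
      have h1 : ∀ i, P i * g.weight (a + 2 * f.innerCount) s t i j = 0 := fun i => by
        by_cases h : P i = 0
        · simp [h]
        · have := hP i h
          rw [g.weight_eq_zero_of_row (by omega) (by unfold Inner at *; rintro rfl; omega)
            (by unfold Inner at *; omega), mul_zero]
      have h2 : ∀ i, Q i * f.weight a s t i j = 0 := fun i => by
        by_cases h : Q i = 0
        · simp [h]
        · have := hQ i h
          rw [f.weight_eq_zero_of_row (by omega) (by unfold Inner at *; rintro rfl; omega)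
            (by unfold Inner at *; omega), mul_zero]
      have h3 : ∑ i ∈ Finset.range N, (P i + Q i) *
            (f.weight a s t i j + g.weight (a + 2 * f.innerCount) s t i j) =
          ∑ i ∈ Finset.range N, P i * f.weight a s t i j +
          ∑ i ∈ Finset.range N, Q i * g.weight (a + 2 * f.innerCount) s t i j := by
        rw [← Finset.sum_add_distrib]
        refine Finset.sum_congr rfl fun i _ => ?_
        linear_combination h1 i + h2 i
      rw [h3]
      have e1 := hP' N (by omega) j
      have e2 := hQ' N (by omega) j
      have e3 : (if j = t then f.toPoly + g.toPoly else 0) =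
        (if j = t then f.toPoly else 0) + (if j = t then g.toPoly else 0) := by
        split_ifs <;> simp
      rw [e3]
      linear_combination e1 + e2
  | mul f g hf hg =>
    intro a s t ha hs ht
    simp only [innerCount] at hs ht
    obtain ⟨P, hP, hP'⟩ := hf (a := a) (s := s) (t := a + 2 * f.innerCount + 1) ha
      (by omega) (by omega)
    obtain ⟨Q, hQ, hQ'⟩ := hg (a := a + 2 * f.innerCount + 2) (s := a + 2 * f.innerCount + 1)
      (t := t) (by omega) (by omega) (by omega)
    set x := a + 2 * f.innerCount + 1 with hx
    refine ⟨fun i => P i + (if i = x then f.toPoly else 0) + f.toPoly * Q i, fun i hi => ?_,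
      fun N hN j => ?_⟩
    · simp only [innerCount]
      by_cases h : P i = 0
      · by_cases h' : i = x
        · unfold Inner
          omega
        · have := hQ i (by rintro h''; simp [h, h', h''] at hi)
          unfold Inner at *
          omega
      · have := hP i h
        unfold Inner at *
        omega
    · simp only [innerCount] at hN
      simp only [weight, toPoly]
      rw [← hx]
      have h1 : ∀ i, P i * g.weight (a + 2 * f.innerCount + 2) x t i j = 0 := fun i => by
        by_cases h : P i = 0
        · simp [h]
        · have := hP i h
          rw [g.weight_eq_zero_of_row (by omega) (by unfold Inner at *; omega)
            (by unfold Inner at *; omega), mul_zero]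
      have h2 : ∀ i, Q i * f.weight a s x i j = 0 := fun i => by
        by_cases h : Q i = 0
        · simp [h]
        · have := hQ i h
          rw [f.weight_eq_zero_of_row (by omega) (by unfold Inner at *; rintro rfl; omega)
            (by unfold Inner at *; omega), mul_zero]
      have h4 : f.weight a s x x j = 0 :=
        f.weight_eq_zero_of_row (by omega) (by omega) (by unfold Inner; omega) _
      have h5 : g.weight (a + 2 * f.innerCount + 2) x t s j = 0 :=
        g.weight_eq_zero_of_row (by omega) (by omega) (by unfold Inner; omega) _
      have h3 : ∑ i ∈ Finset.range N, (P i + (if i = x then f.toPoly else 0) + f.toPoly * Q i) *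
            (f.weight a s x i j + g.weight (a + 2 * f.innerCount + 2) x t i j) =
          ∑ i ∈ Finset.range N, P i * f.weight a s x i j +
          (∑ i ∈ Finset.range N, if i = x then
            f.toPoly * g.weight (a + 2 * f.innerCount + 2) x t x j else 0) +
          f.toPoly * ∑ i ∈ Finset.range N,
            Q i * g.weight (a + 2 * f.innerCount + 2) x t i j := by
        rw [Finset.mul_sum, ← Finset.sum_add_distrib, ← Finset.sum_add_distrib]
        refine Finset.sum_congr rfl fun i _ => ?_
        by_cases h : i = x
        · rw [if_pos h, if_pos h, h]
          linear_combination h1 x + f.toPoly * h2 x + f.toPoly * h4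
        · simp only [h, if_false]
          linear_combination h1 i + f.toPoly * h2 i
      rw [h3, Finset.sum_ite_eq' (Finset.range N) x, if_pos (by simp; omega), h5]
      have e1 := hP' N (by omega) j
      have e2 := hQ' N (by omega) j
      have e3 : (if j = t then f.toPoly * g.toPoly else 0) =
        f.toPoly * (if j = t then g.toPoly else 0) := by
        split_ifs <;> simp
      rw [e3]
      linear_combination e1 + f.toPoly * e2

end Formula

/-- A rooted tree-decomposition, given by the parent function `par` of its tree and its bags `X`:
for every vertex at most one bag containing it has no parent containing it. -/
structure IsRootedDecomposition {I V : Type} (par : I → Option I) (root : I) (X : I → Finset V) :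
    Prop where
  par_eq_none : ∀ i, par i = none ↔ i = root
  exists_rank : ∃ rank : I → ℕ, ∀ i j, par i = some j → rank j < rank i
  top_unique : ∀ v i j, v ∈ X i → v ∈ X j → (∀ p, par i = some p → v ∉ X p) →
    (∀ p, par j = some p → v ∉ X p) → i = j

/-- The tree of a parent function. -/
def parentGraph {I : Type} (par : I → Option I) : SimpleGraph I :=
  SimpleGraph.fromRel fun i j => par i = some j

theorem parentGraph_adj {I : Type} {par : I → Option I} {rank : I → ℕ}
    (hr : ∀ i j, par i = some j → rank j < rank i) {i j : I} (h : par i = some j) :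
    (parentGraph par).Adj i j := by
  refine (SimpleGraph.fromRel_adj _ _ _).2 ⟨?_, Or.inl h⟩
  rintro rfl
  exact lt_irrefl _ (hr _ _ h)

theorem parentGraph_induce_connected {I : Type} {par : I → Option I} {rank : I → ℕ}
    (hr : ∀ i j, par i = some j → rank j < rank i) (S : Set I) (hS : S.Nonempty)
    (htop : ∀ i ∈ S, ∀ j ∈ S, (∀ p, par i = some p → p ∉ S) → (∀ p, par j = some p → p ∉ S) →
      i = j) :
    ((parentGraph par).induce S).Connected := by
  have key : ∀ n, ∀ i : S, rank i ≤ n → ∃ r : S, (∀ p, par r = some p → p ∉ S) ∧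
      ((parentGraph par).induce S).Reachable i r := by
    intro n
    induction n with
    | zero =>
      intro i hi
      refine ⟨i, fun p hp _ => ?_, SimpleGraph.Reachable.refl _⟩
      have := hr _ _ hp
      omega
    | succ n ih =>
      intro i hi
      by_cases h : ∀ p, par i = some p → p ∉ S
      · exact ⟨i, h, SimpleGraph.Reachable.refl _⟩
      · push Not at h
        obtain ⟨p, hp, hpS⟩ := h
        have := hr _ _ hp
        obtain ⟨r, h1, h2⟩ := ih ⟨p, hpS⟩ (by simp only; omega)
        refine ⟨r, h1, SimpleGraph.Reachable.trans (SimpleGraph.Adj.reachable ?_) h2⟩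
        exact SimpleGraph.comap_adj.2 (parentGraph_adj hr hp)
  have : Nonempty S := hS.to_subtype
  refine ⟨fun i j => ?_⟩
  obtain ⟨r, h1, h2⟩ := key _ i le_rfl
  obtain ⟨r', h1', h2'⟩ := key _ j le_rfl
  have : r = r' := Subtype.ext (htop r r.2 r' r'.2 h1 h1')
  subst this
  exact h2.trans h2'.symm

theorem parentGraph_isTree {I : Type} [Finite I] {par : I → Option I} {root : I} {rank : I → ℕ}
    (hroot : ∀ i, par i = none ↔ i = root) (hr : ∀ i j, par i = some j → rank j < rank i) :
    (parentGraph par).IsTree := by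
  have hc : (parentGraph par).Connected := by
    have := parentGraph_induce_connected hr Set.univ ⟨root, trivial⟩ (by
      intro i _ j _ hi hj
      have aux : ∀ i, (∀ p, par i = some p → p ∉ Set.univ) → i = root := fun i hi => by
        rw [← hroot]
        by_contra h
        obtain ⟨p, hp⟩ := Option.ne_none_iff_exists'.1 h
        exact hi p hp trivial
      rw [aux i hi, aux j hj])
    exact (SimpleGraph.induceUnivIso _).connected_iff.1 this
  rw [SimpleGraph.isTree_iff_connected_and_card]
  refine ⟨hc, le_antisymm ?_ hc.card_vert_le_card_edgeSet_add_one⟩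
  have hsub : (parentGraph par).edgeSet ⊆
      (fun i => s(i, (par i).getD i)) '' ({root}ᶜ : Set I) := by
    intro e
    induction e using Sym2.ind with
    | _ i j =>
      intro h
      rw [SimpleGraph.mem_edgeSet] at h
      rcases ((SimpleGraph.fromRel_adj _ _ _).1 h).2 with h | h
      · refine ⟨i, fun hi => ?_, by simp [h]⟩
        rw [(hroot i).2 hi] at h
        cases h
      · refine ⟨j, fun hi => ?_, by simp [h, Sym2.eq_swap]⟩
        rw [(hroot j).2 hi] at h
        cases h
  have h1 := Set.ncard_le_ncard hsub (Set.toFinite _)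
  have h2 := Set.ncard_image_le (f := fun i => s(i, (par i).getD i))
    (Set.toFinite ({root}ᶜ : Set I))
  have h3 := Set.ncard_add_ncard_compl ({root} : Set I)
  rw [Set.ncard_singleton] at h3
  rw [Nat.card_coe_set_eq]
  omega

theorem IsRootedDecomposition.hasTreewidthAtMost {I V : Type} [Finite I] {par : I → Option I}
    {root : I} {X : I → Finset V} (h : IsRootedDecomposition par root X) (G : SimpleGraph V) (k : ℕ)
    (hcard : ∀ i, (X i).card ≤ k + 1) (hV : ∀ v, ∃ i, v ∈ X i)
    (hE : ∀ u v, G.Adj u v → ∃ i, u ∈ X i ∧ v ∈ X i) : HasTreewidthAtMost G k := by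
  obtain ⟨rank, hr⟩ := h.exists_rank
  let e := Finite.equivFin I
  let f : (parentGraph par).comap e.symm ≃g parentGraph par := SimpleGraph.Iso.comap e.symm _
  refine ⟨Nat.card I, (parentGraph par).comap e.symm, fun i => X (e.symm i), ?_, fun t => hcard _,
    fun v => ?_, fun u v huv => ?_, fun v => ?_⟩
  · exact f.isTree_iff.2 (parentGraph_isTree h.par_eq_none hr)
  · obtain ⟨i, hi⟩ := hV v
    exact ⟨e i, by simpa using hi⟩
  · obtain ⟨i, hi⟩ := hE u v huv
    exact ⟨e i, by simpa using hi⟩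
  · have hc := parentGraph_induce_connected hr {i | v ∈ X i} (hV v)
      fun i hi j hj hi' hj' => h.top_unique v i j hi hj hi' hj'
    let g : ((parentGraph par).comap e.symm).induce {t | v ∈ X (e.symm t)} ≃g
        (parentGraph par).induce {i | v ∈ X i} :=
      { toEquiv := e.symm.subtypeEquiv fun _ => Iff.rfl
        map_rel_iff' := Iff.rfl }
    exact g.connected_iff.2 hc

theorem IsRootedDecomposition.leaf {V : Type} (B : Finset V) :
    IsRootedDecomposition (fun _ : Unit => none) () (fun _ => B) where
  par_eq_none := by simp
  exists_rank := ⟨fun _ => 0, by simp⟩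
  top_unique := by simp

/-- The parent function of the tree obtained by joining two rooted trees below a new root. -/
def joinPar {I J : Type} (par₁ : I → Option I) (par₂ : J → Option J) :
    Option (I ⊕ J) → Option (Option (I ⊕ J))
  | none => none
  | some (Sum.inl i) => some ((par₁ i).map Sum.inl)
  | some (Sum.inr j) => some ((par₂ j).map Sum.inr)

/-- The bags of the join of two tree-decompositions below a new bag `B`. -/
def joinBag {I J V : Type} (B : Finset V) (X₁ : I → Finset V) (X₂ : J → Finset V) :
    Option (I ⊕ J) → Finset V
  | none => B
  | some (Sum.inl i) => X₁ i
  | some (Sum.inr j) => X₂ j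

theorem IsRootedDecomposition.join {I J V : Type} {par₁ : I → Option I} {par₂ : J → Option J}
    {r₁ : I} {r₂ : J} {X₁ : I → Finset V} {X₂ : J → Finset V}
    (h₁ : IsRootedDecomposition par₁ r₁ X₁) (h₂ : IsRootedDecomposition par₂ r₂ X₂) (B : Finset V)
    (hB₁ : ∀ i, ∀ v ∈ X₁ i, v ∈ B → v ∈ X₁ r₁) (hB₂ : ∀ j, ∀ v ∈ X₂ j, v ∈ B → v ∈ X₂ r₂)
    (h₁₂ : ∀ i j, ∀ v ∈ X₁ i, v ∈ X₂ j → v ∈ B) :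
    IsRootedDecomposition (joinPar par₁ par₂) none (joinBag B X₁ X₂) where
  par_eq_none := by
    rintro (_ | i | j) <;> simp [joinPar]
  exists_rank := by
    obtain ⟨k₁, hk₁⟩ := h₁.exists_rank
    obtain ⟨k₂, hk₂⟩ := h₂.exists_rank
    refine ⟨fun x => match x with
      | none => 0
      | some (Sum.inl i) => k₁ i + 1
      | some (Sum.inr j) => k₂ j + 1, ?_⟩
    rintro (_ | i | j) q hq
    · cases hq
    · cases Option.some.inj hq
      rcases hp : par₁ i with _ | p
      · simp
      · simpa using hk₁ _ _ hp
    · cases Option.some.inj hq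
      rcases hp : par₂ j with _ | p
      · simp
      · simpa using hk₂ _ _ hp
  top_unique := by
    have aux₁ : ∀ v i, v ∈ X₁ i → (∀ p, joinPar par₁ par₂ (some (Sum.inl i)) = some p →
        v ∉ joinBag B X₁ X₂ p) → v ∉ B ∧ ∀ p, par₁ i = some p → v ∉ X₁ p := by
      intro v i hi ht
      have ht' : ∀ p, par₁ i = some p → v ∉ X₁ p := fun p hp =>
        ht (some (Sum.inl p)) (by simp [joinPar, hp])
      refine ⟨fun hB => ?_, ht'⟩
      have hr := (h₁.par_eq_none r₁).2 rfl
      have := h₁.top_unique v i r₁ hi (hB₁ i v hi hB) ht' (by simp [hr])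
      subst this
      exact ht none (by simp [joinPar, hr]) hB
    have aux₂ : ∀ v i, v ∈ X₂ i → (∀ p, joinPar par₁ par₂ (some (Sum.inr i)) = some p →
        v ∉ joinBag B X₁ X₂ p) → v ∉ B ∧ ∀ p, par₂ i = some p → v ∉ X₂ p := by
      intro v i hi ht
      have ht' : ∀ p, par₂ i = some p → v ∉ X₂ p := fun p hp =>
        ht (some (Sum.inr p)) (by simp [joinPar, hp])
      refine ⟨fun hB => ?_, ht'⟩
      have hr := (h₂.par_eq_none r₂).2 rfl
      have := h₂.top_unique v i r₂ hi (hB₂ i v hi hB) ht' (by simp [hr])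
      subst this
      exact ht none (by simp [joinPar, hr]) hB
    rintro v (_ | i | i) (_ | j | j) hi hj hti htj
    · rfl
    · exact absurd hi (aux₁ v j hj htj).1
    · exact absurd hi (aux₂ v j hj htj).1
    · exact absurd hj (aux₁ v i hi hti).1
    · rw [h₁.top_unique v i j hi hj (aux₁ v i hi hti).2 (aux₁ v j hj htj).2]
    · exact absurd (h₁₂ i j v hi hj) (aux₁ v i hi hti).1
    · exact absurd hj (aux₂ v i hi hti).1
    · exact absurd (h₁₂ j i v hj hi) (aux₁ v j hj htj).1
    · rw [h₂.top_unique v i j hi hj (aux₂ v i hi hti).2 (aux₂ v j hj htj).2]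

/-- The edges of the return path through the even numbers, with an optional detour through the
odd number in between. -/
def ReturnEdge (i j : ℕ) : Prop := i = j + 1 ∨ (i = j + 2 ∧ j % 2 = 0)

theorem card_insert_seven_le (x₁ x₂ x₃ x₄ x₅ x₆ x₇ : ℕ) :
    ({x₁, x₂, x₃, x₄, x₅, x₆, x₇} : Finset ℕ).card ≤ 7 :=
  (Finset.card_insert_le _ _).trans (Nat.succ_le_succ Finset.card_le_six)

theorem exists_decomposition_leaf {R : Type} [CommRing R] (x : R) {a : ℕ} (ha : a % 2 = 0)
    (s t : ℕ) :
    ∃ (I : Type) (_ : Finite I) (par : I → Option I) (root : I) (X : I → Finset ℕ),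
      IsRootedDecomposition par root X ∧ (∀ i, (X i).card ≤ 7) ∧
      (∀ v, v = s ∨ v = t ∨ v = a ∨ v = a + 2 → v ∈ X root) ∧
      (∀ i, ∀ v ∈ X i, v = s ∨ v = t ∨ (a ≤ v ∧ v ≤ a + 2)) ∧
      (∀ v, a ≤ v → v ≤ a + 2 → ∃ i, v ∈ X i) ∧
      (∀ u v, a ≤ v → u ≤ a + 2 → ReturnEdge u v → ∃ i, u ∈ X i ∧ v ∈ X i) ∧
      (∀ u v, Formula.leafWeight x a s t u v ≠ 0 → ∃ i, u ∈ X i ∧ v ∈ X i) := by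
  refine ⟨Unit, inferInstance, fun _ => none, (), fun _ => {s, t, a, a + 1, a + 2},
    IsRootedDecomposition.leaf _, fun _ => Finset.card_le_five.trans (by norm_num), ?_, ?_, ?_, ?_,
    ?_⟩
  · intro v hv
    simp only [Finset.mem_insert, Finset.mem_singleton]
    omega
  · intro _ v hv
    simp only [Finset.mem_insert, Finset.mem_singleton] at hv
    omega
  · intro v h1 h2
    refine ⟨(), ?_⟩
    simp only [Finset.mem_insert, Finset.mem_singleton]
    omega
  · intro u v h1 h2 h3
    refine ⟨(), ?_⟩
    unfold ReturnEdge at h3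
    simp only [Finset.mem_insert, Finset.mem_singleton]
    omega
  · intro u v h
    have := Formula.leafWeight_ne_zero ha h
    refine ⟨(), ?_⟩
    unfold Formula.Inner at this
    simp only [Finset.mem_insert, Finset.mem_singleton]
    omega

/-- The digraph of a formula, together with its part of the return path, has a rooted
tree-decomposition of width at most 6 whose root bag contains its four terminals. -/
theorem Formula.exists_decomposition {K ν : Type} [CommRing K] (φ : Formula K ν) :
    ∀ {a s t : ℕ}, a % 2 = 0 → ¬ (a < s ∧ s < a + 2 * φ.innerCount) →
      ¬ (a < t ∧ t < a + 2 * φ.innerCount) →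
    ∃ (I : Type) (_ : Finite I) (par : I → Option I) (root : I) (X : I → Finset ℕ),
      IsRootedDecomposition par root X ∧ (∀ i, (X i).card ≤ 7) ∧
      (∀ v, v = s ∨ v = t ∨ v = a ∨ v = a + 2 * φ.innerCount → v ∈ X root) ∧
      (∀ i, ∀ v ∈ X i, v = s ∨ v = t ∨ (a ≤ v ∧ v ≤ a + 2 * φ.innerCount)) ∧
      (∀ v, a ≤ v → v ≤ a + 2 * φ.innerCount → ∃ i, v ∈ X i) ∧
      (∀ u v, a ≤ v → u ≤ a + 2 * φ.innerCount → ReturnEdge u v → ∃ i, u ∈ X i ∧ v ∈ X i) ∧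
      (∀ u v, φ.weight a s t u v ≠ 0 → ∃ i, u ∈ X i ∧ v ∈ X i) := by
  induction φ with
  | const c => intro a s t ha _ _; exact exists_decomposition_leaf _ ha s t
  | var c => intro a s t ha _ _; exact exists_decomposition_leaf _ ha s t
  | add f g hf hg =>
    intro a s t ha hs ht
    simp only [innerCount] at hs ht ⊢
    have hfp := f.innerCount_pos
    have hgp := g.innerCount_pos
    obtain ⟨I, _, par₁, r₁, X₁, hd₁, hc₁, hr₁, hs₁, hv₁, he₁, hw₁⟩ :=
      hf (a := a) (s := s) (t := t) ha (by omega) (by omega)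
    obtain ⟨J, _, par₂, r₂, X₂, hd₂, hc₂, hr₂, hs₂, hv₂, he₂, hw₂⟩ :=
      hg (a := a + 2 * f.innerCount) (s := s) (t := t) (by omega) (by omega) (by omega)
    refine ⟨Option (I ⊕ J), inferInstance, joinPar par₁ par₂, none,
      joinBag {s, t, a, a + 2 * f.innerCount, a + 2 * (f.innerCount + g.innerCount)} X₁ X₂,
      hd₁.join hd₂ _ ?_ ?_ ?_, ?_, ?_, ?_, ?_, ?_, ?_⟩
    · intro i v hv hB
      have := hs₁ i v hv
      simp only [Finset.mem_insert, Finset.mem_singleton] at hB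
      exact hr₁ v (by omega)
    · intro i v hv hB
      have := hs₂ i v hv
      simp only [Finset.mem_insert, Finset.mem_singleton] at hB
      exact hr₂ v (by omega)
    · intro i j v hv hv'
      have h1 := hs₁ i v hv
      have h2 := hs₂ j v hv'
      simp only [Finset.mem_insert, Finset.mem_singleton]
      omega
    · rintro (_ | i | j)
      · exact Finset.card_le_five.trans (by norm_num)
      · exact hc₁ i
      · exact hc₂ j
    · intro v hv
      simp only [joinBag, Finset.mem_insert, Finset.mem_singleton]
      omega
    · rintro (_ | i | j) v hv
      · simp only [joinBag, Finset.mem_insert, Finset.mem_singleton] at hv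
        omega
      · have := hs₁ i v hv
        omega
      · have := hs₂ j v hv
        omega
    · intro v h1 h2
      by_cases h : v ≤ a + 2 * f.innerCount
      · obtain ⟨i, hi⟩ := hv₁ v h1 h
        exact ⟨some (Sum.inl i), hi⟩
      · obtain ⟨i, hi⟩ := hv₂ v (by omega) (by omega)
        exact ⟨some (Sum.inr i), hi⟩
    · intro u v h1 h2 h3
      by_cases h : u ≤ a + 2 * f.innerCount
      · obtain ⟨i, hi⟩ := he₁ u v h1 h h3
        exact ⟨some (Sum.inl i), hi⟩
      · obtain ⟨i, hi⟩ := he₂ u v (by unfold ReturnEdge at h3; omega) (by omega) h3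
        exact ⟨some (Sum.inr i), hi⟩
    · intro u v h
      simp only [weight] at h
      by_cases h1 : f.weight a s t u v = 0
      · rw [h1, zero_add] at h
        obtain ⟨i, hi⟩ := hw₂ u v h
        exact ⟨some (Sum.inr i), hi⟩
      · obtain ⟨i, hi⟩ := hw₁ u v h1
        exact ⟨some (Sum.inl i), hi⟩
  | mul f g hf hg =>
    intro a s t ha hs ht
    simp only [innerCount] at hs ht ⊢
    have hfp := f.innerCount_pos
    have hgp := g.innerCount_pos
    obtain ⟨I, _, par₁, r₁, X₁, hd₁, hc₁, hr₁, hs₁, hv₁, he₁, hw₁⟩ :=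
      hf (a := a) (s := s) (t := a + 2 * f.innerCount + 1) ha (by omega) (by omega)
    obtain ⟨J, _, par₂, r₂, X₂, hd₂, hc₂, hr₂, hs₂, hv₂, he₂, hw₂⟩ :=
      hg (a := a + 2 * f.innerCount + 2) (s := a + 2 * f.innerCount + 1) (t := t)
        (by omega) (by omega) (by omega)
    refine ⟨Option (I ⊕ J), inferInstance, joinPar par₁ par₂, none,
      joinBag {s, t, a, a + 2 * f.innerCount, a + 2 * f.innerCount + 1, a + 2 * f.innerCount + 2,
        a + 2 * (f.innerCount + g.innerCount + 1)} X₁ X₂,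
      hd₁.join hd₂ _ ?_ ?_ ?_, ?_, ?_, ?_, ?_, ?_, ?_⟩
    · intro i v hv hB
      have := hs₁ i v hv
      simp only [Finset.mem_insert, Finset.mem_singleton] at hB
      exact hr₁ v (by omega)
    · intro i v hv hB
      have := hs₂ i v hv
      simp only [Finset.mem_insert, Finset.mem_singleton] at hB
      exact hr₂ v (by omega)
    · intro i j v hv hv'
      have h1 := hs₁ i v hv
      have h2 := hs₂ j v hv'
      simp only [Finset.mem_insert, Finset.mem_singleton]
      omega
    · rintro (_ | i | j)
      · exact card_insert_seven_le _ _ _ _ _ _ _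
      · exact hc₁ i
      · exact hc₂ j
    · intro v hv
      simp only [joinBag, Finset.mem_insert, Finset.mem_singleton]
      omega
    · rintro (_ | i | j) v hv
      · simp only [joinBag, Finset.mem_insert, Finset.mem_singleton] at hv
        omega
      · have := hs₁ i v hv
        omega
      · have := hs₂ j v hv
        omega
    · intro v h1 h2
      by_cases h : v ≤ a + 2 * f.innerCount
      · obtain ⟨i, hi⟩ := hv₁ v h1 h
        exact ⟨some (Sum.inl i), hi⟩
      · by_cases h' : v = a + 2 * f.innerCount + 1
        · exact ⟨none, by simp [joinBag, h']⟩
        · obtain ⟨i, hi⟩ := hv₂ v (by omega) (by omega)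
          exact ⟨some (Sum.inr i), hi⟩
    · intro u v h1 h2 h3
      by_cases h : u ≤ a + 2 * f.innerCount
      · obtain ⟨i, hi⟩ := he₁ u v h1 h h3
        exact ⟨some (Sum.inl i), hi⟩
      · by_cases h' : u ≤ a + 2 * f.innerCount + 2
        · refine ⟨none, ?_⟩
          unfold ReturnEdge at h3
          simp only [joinBag, Finset.mem_insert, Finset.mem_singleton]
          omega
        · obtain ⟨i, hi⟩ := he₂ u v (by unfold ReturnEdge at h3; omega) (by omega) h3
          exact ⟨some (Sum.inr i), hi⟩
    · intro u v h
      simp only [weight] at h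
      by_cases h1 : f.weight a s (a + 2 * f.innerCount + 1) u v = 0
      · rw [h1, zero_add] at h
        obtain ⟨i, hi⟩ := hw₂ u v h
        exact ⟨some (Sum.inr i), hi⟩
      · obtain ⟨i, hi⟩ := hw₁ u v h1
        exact ⟨some (Sum.inl i), hi⟩

/-- The edges of the weighted digraph `D` lead upwards, from `0` or an odd number to an odd number
or `2 * k`. -/
structure IsForwardWeight {R : Type} [CommRing R] (k : ℕ) (D : ℕ → ℕ → R) : Prop where
  lt : ∀ i j, D i j ≠ 0 → i < j
  row : ∀ i j, D i j ≠ 0 → i = 0 ∨ i % 2 = 1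
  col : ∀ i j, D i j ≠ 0 → j = 2 * k ∨ j % 2 = 1

/-- The digraph `D` together with the return path. -/
noncomputable def returnWeight {R : Type} [CommRing R] (D : ℕ → ℕ → R) (i j : ℕ) : R :=
  (if ReturnEdge i j then 1 else 0) + D i j

theorem IsForwardWeight.returnWeight_ne_zero {R : Type} [CommRing R] {k : ℕ} {D : ℕ → ℕ → R}
    (hD : IsForwardWeight k D) {i j : ℕ} (h : returnWeight D i j ≠ 0) :
    ReturnEdge i j ∨ (i < j ∧ (i = 0 ∨ i % 2 = 1) ∧ (j = 2 * k ∨ j % 2 = 1)) := by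
  by_cases h1 : ReturnEdge i j
  · exact Or.inl h1
  · rw [returnWeight, if_neg h1, zero_add] at h
    exact Or.inr ⟨hD.lt _ _ h, hD.row _ _ h, hD.col _ _ h⟩

/-- The matrix of the digraph `D` together with the return path. -/
noncomputable def returnMatrix {R : Type} [CommRing R] (k : ℕ) (D : ℕ → ℕ → R) :
    Matrix (Fin (2 * k + 1)) (Fin (2 * k + 1)) R :=
  Matrix.of fun i j => returnWeight D i j

/-- Every cycle cover of the digraph is a Hamiltonian cycle. -/
theorem IsForwardWeight.sameCycle {R : Type} [CommRing R] {k : ℕ} {D : ℕ → ℕ → R}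
    (hD : IsForwardWeight k D) (σ : Equiv.Perm (Fin (2 * k + 1)))
    (hσ : ∀ i, returnMatrix k D i (σ i) ≠ 0) (i : Fin (2 * k + 1)) : σ.SameCycle 0 i := by
  have hσ' : ∀ i : Fin (2 * k + 1), ReturnEdge i (σ i) ∨
      ((i : ℕ) < σ i ∧ ((i : ℕ) = 0 ∨ (i : ℕ) % 2 = 1) ∧ ((σ i : ℕ) = 2 * k ∨ (σ i : ℕ) % 2 = 1)) :=
    fun i => hD.returnWeight_ne_zero (hσ i)
  have heven : ∀ r, ∀ hr : 2 * r < 2 * k + 1, σ.SameCycle 0 ⟨2 * r, hr⟩ := by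
    intro r
    induction r with
    | zero => intro hr; exact Equiv.Perm.SameCycle.refl _ _
    | succ r ih =>
      intro hr
      have h0 := ih (by omega)
      refine h0.trans ?_
      set u : Fin (2 * k + 1) := ⟨2 * r, by omega⟩ with hu
      set v : Fin (2 * k + 1) := ⟨2 * r + 1, by omega⟩ with hv
      set w : Fin (2 * k + 1) := ⟨2 * (r + 1), hr⟩ with hw
      have hwu : σ w = u ∨ σ w = v := by
        have := hσ' w
        have e : (w : ℕ) = 2 * (r + 1) := rfl
        rw [e] at this
        unfold ReturnEdge at this
        rw [Fin.ext_iff, Fin.ext_iff]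
        change (σ w : ℕ) = 2 * r ∨ (σ w : ℕ) = 2 * r + 1
        omega
      have hpre : σ.symm u = w ∨ σ.symm u = v := by
        have := hσ' (σ.symm u)
        rw [Equiv.apply_symm_apply] at this
        have e : (u : ℕ) = 2 * r := rfl
        rw [e] at this
        unfold ReturnEdge at this
        rw [Fin.ext_iff, Fin.ext_iff]
        change (σ.symm u : ℕ) = 2 * (r + 1) ∨ (σ.symm u : ℕ) = 2 * r + 1
        omega
      have hwσ : σ.SameCycle w (σ w) := Equiv.Perm.sameCycle_apply_right.2 (.refl _ _)
      rcases hwu with h | h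
      · rw [h] at hwσ
        exact hwσ.symm
      · rw [h] at hwσ
        rcases hpre with h' | h'
        · have : σ w = u := by rw [← h', Equiv.apply_symm_apply]
          rw [this, Fin.ext_iff] at h
          simp [hu, hv] at h
        · have h2 : σ v = u := by rw [← h', Equiv.apply_symm_apply]
          have hvσ : σ.SameCycle v (σ v) := Equiv.Perm.sameCycle_apply_right.2 (.refl _ _)
          rw [h2] at hvσ
          exact (hwσ.trans hvσ).symm
  have key : ∀ d, ∀ i : Fin (2 * k + 1), 2 * k - (i : ℕ) ≤ d → σ.SameCycle 0 i := by
    intro d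
    induction d with
    | zero =>
      intro i hi
      have := heven k (by omega)
      convert this
      omega
    | succ d ih =>
      intro i hi
      rcases Nat.mod_two_eq_zero_or_one i with h | h
      · have := heven (i / 2) (by omega)
        convert this
        omega
      · rw [← Equiv.Perm.sameCycle_apply_right]
        have h1 := hσ' i
        unfold ReturnEdge at h1
        have hi2 := i.2
        rcases Nat.mod_two_eq_zero_or_one (σ i) with h2 | h2
        · have := heven (σ i / 2) (by omega)
          convert this
          omega
        · exact ih _ (by omega)
  exact key _ i le_rfl

theorem IsForwardWeight.ham_eq_det {R : Type} [CommRing R] {k : ℕ} {D : ℕ → ℕ → R}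
    (hD : IsForwardWeight k D) (hk : 0 < k) : ham (returnMatrix k D) = (returnMatrix k D).det := by
  rw [← Matrix.det_transpose, Matrix.det_apply', ham, Finset.sum_filter]
  refine Finset.sum_congr rfl fun σ _ => ?_
  simp only [Matrix.transpose_apply]
  split_ifs with h
  · rw [h.1.sign, h.2]
    simp [pow_succ, pow_mul]
  · by_cases hz : ∃ i, returnMatrix k D i (σ i) = 0
    · obtain ⟨i, hi⟩ := hz
      rw [Finset.prod_eq_zero (Finset.mem_univ i) hi, mul_zero]
    · push Not at hz
      refine absurd ?_ h
      have hs := hD.sameCycle σ hz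
      have hne : ∀ i, σ i ≠ i := fun i hi => by
        have h1 : σ.SameCycle i ⟨0, by omega⟩ := (hs i).symm
        have h2 : σ.SameCycle i ⟨1, by omega⟩ := (hs i).symm.trans (hs _)
        rw [Equiv.Perm.SameCycle.eq_1] at h1 h2
        have hfix : ∀ n : ℤ, (σ ^ n) i = i := fun n =>
          Function.IsFixedPt.perm_zpow hi n
        obtain ⟨m, hm⟩ := h1
        obtain ⟨n, hn⟩ := h2
        rw [hfix] at hm hn
        rw [hm, Fin.ext_iff] at hn
        simp at hn
      refine ⟨(Equiv.Perm.isCycle_iff_sameCycle (hne 0)).2 fun {y} =>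
        ⟨fun _ => hne y, fun _ => hs y⟩, ?_⟩
      ext i
      simp [hne i]

/-- In the minor avoiding the row of the source and the column of the sink, only the diagonal
contributes to the determinant. -/
theorem IsForwardWeight.det_minor {R : Type} [CommRing R] {k : ℕ} {D : ℕ → ℕ → R}
    (hD : IsForwardWeight k D) :
    ((returnMatrix k D).submatrix Fin.succ Fin.castSucc).det = 1 := by
  rw [Matrix.det_apply', Finset.sum_eq_single 1]
  · simp only [Equiv.Perm.sign_one, Equiv.Perm.one_apply, Matrix.submatrix_apply]
    rw [Finset.prod_eq_one]
    · simp
    · intro i _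
      have h1 : D (i + 1) i = 0 := by
        by_contra h
        have := hD.lt _ _ h
        omega
      simp [returnMatrix, returnWeight, ReturnEdge, h1]
  · intro σ _ hσ
    by_contra hne
    apply hσ
    have hz : ∀ i : Fin (2 * k), ReturnEdge ((σ i : ℕ) + 1) i ∨ ((σ i : ℕ) + 1 < i ∧
        ((σ i : ℕ) + 1 = 0 ∨ ((σ i : ℕ) + 1) % 2 = 1) ∧ ((i : ℕ) = 2 * k ∨ (i : ℕ) % 2 = 1)) := by
      intro i
      have : returnWeight D ((σ i : ℕ) + 1) i ≠ 0 := fun h => hne (by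
        rw [Finset.prod_eq_zero (Finset.mem_univ i) (by simpa [returnMatrix] using h), mul_zero])
      exact hD.returnWeight_ne_zero this
    have key : ∀ n, ∀ i : Fin (2 * k), (i : ℕ) = n → σ i = i := by
      intro n
      induction n using Nat.strong_induction_on with
      | _ n ih =>
        intro i hi
        have hback : ∀ j : Fin (2 * k), (σ j : ℕ) < n → σ j = j := fun j hj =>
          σ.injective (ih _ hj (σ j) rfl)
        have h1 := hz i
        have hi2 := i.2
        unfold ReturnEdge at h1
        by_cases hlt : (σ i : ℕ) < n
        · exact hback i hlt
        · by_cases heq : (σ i : ℕ) = i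
          · exact Fin.ext heq
          · exfalso
            have e1 : (σ i : ℕ) = i + 1 := by omega
            have hlt2 := (σ i).2
            have h2 := hz (σ i)
            unfold ReturnEdge at h2
            by_cases hlt' : (σ (σ i) : ℕ) < n
            · have := hback _ hlt'
              rw [this] at hlt'
              omega
            · have : σ (σ i) = σ i := Fin.ext (by omega)
              have := σ.injective this
              rw [this] at e1
              omega
    exact Equiv.ext fun i => key _ i rfl
  · simp

theorem IsForwardWeight.det_eq {R : Type} [CommRing R] {k : ℕ} {D : ℕ → ℕ → R}
    (hD : IsForwardWeight k D) (P : ℕ → R) (hP : ∀ i, P i ≠ 0 → i % 2 = 1 ∧ i < 2 * k) (c : R)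
    (hPD : ∀ j, ∑ i ∈ Finset.range (2 * k + 1), P i * D i j + D 0 j =
      P j + if j = 2 * k then c else 0) :
    (returnMatrix k D).det = c := by
  have hP0 : ∀ i, ¬ (i % 2 = 1 ∧ i < 2 * k) → P i = 0 := fun i h => by
    by_contra h'
    exact h (hP i h')
  let q : ℕ → R := fun i => if i = 0 then 1 else if i % 2 = 1 then P i else - P (i - 1)
  have hq1 : ∀ i, i % 2 = 1 → q i = P i := fun i hi => by
    have : i ≠ 0 := by omega
    simp [q, hi, this]
  have hq2 : ∀ i, i % 2 = 1 → q (i + 1) = - P i := fun i hi => by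
    have : (i + 1) % 2 ≠ 1 := by omega
    simp [q, this]
  have hqD : ∀ i j, q i * D i j = P i * D i j + if i = 0 then D 0 j else 0 := by
    intro i j
    by_cases h : D i j = 0
    · by_cases h0 : i = 0
      · subst h0
        simp [h]
      · simp [h, h0]
    · rcases hD.row _ _ h with h0 | h0
      · subst h0
        simp [q, hP0 0 (by omega)]
      · have : i ≠ 0 := by omega
        simp [hq1 i h0, this]
  have hret : ∀ j, j < 2 * k + 1 →
      ∑ i ∈ Finset.range (2 * k + 1), q i * (if ReturnEdge i j then (1 : R) else 0) = - P j := by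
    intro j hj
    have hsplit : ∀ i, q i * (if ReturnEdge i j then (1 : R) else 0) =
        (if i = j + 1 then q (j + 1) else 0) +
        (if i = j + 2 then (if j % 2 = 0 then q (j + 2) else 0) else 0) := by
      intro i
      unfold ReturnEdge
      by_cases h1 : i = j + 1
      · subst h1
        simp
      · by_cases h2 : i = j + 2
        · subst h2
          simp
        · simp [h1, h2]
    simp only [hsplit]
    rw [Finset.sum_add_distrib, Finset.sum_ite_eq', Finset.sum_ite_eq']
    simp only [Finset.mem_range]
    by_cases hj' : j = 2 * k
    · rw [if_neg (by omega), if_neg (by omega), hP0 j (by omega)]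
      simp
    · rw [if_pos (by omega)]
      rcases Nat.mod_two_eq_zero_or_one j with h | h
      · rw [if_pos (by omega), if_pos h, hq1 _ (by omega), hq2 (j + 1) (by omega),
          hP0 j (by omega)]
        simp
      · rw [if_neg (by omega : ¬ j % 2 = 0), hq2 j h]
        simp
  have hrow : ∀ j : Fin (2 * k + 1), (∑ i : Fin (2 * k + 1), q i • returnMatrix k D i) j =
      if j = Fin.last (2 * k) then c else 0 := by
    intro j
    rw [Finset.sum_apply]
    simp only [Pi.smul_apply, smul_eq_mul, returnMatrix, Matrix.of_apply]
    rw [Fin.sum_univ_eq_sum_range (fun i => q i * returnWeight D i j) (2 * k + 1)]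
    simp only [returnWeight, mul_add, hqD]
    rw [Finset.sum_add_distrib, Finset.sum_add_distrib, hret j j.2, Finset.sum_ite_eq',
      if_pos (by simp)]
    have e : (j = Fin.last (2 * k)) ↔ (j : ℕ) = 2 * k := by rw [Fin.ext_iff]; rfl
    simp only [e]
    linear_combination hPD j
  have h1 := Matrix.det_updateRow_sum (returnMatrix k D) 0 (fun i => q i)
  have hq0 : q ((0 : Fin (2 * k + 1)) : ℕ) = 1 := by simp [q]
  rw [hq0, one_smul] at h1
  rw [← h1, Matrix.det_succ_row_zero, Finset.sum_eq_single (Fin.last (2 * k))]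
  · rw [Matrix.updateRow_self, hrow, if_pos rfl]
    have : ((returnMatrix k D).updateRow 0
        (∑ i : Fin (2 * k + 1), q i • returnMatrix k D i)).submatrix Fin.succ
          (Fin.last (2 * k)).succAbove =
        (returnMatrix k D).submatrix Fin.succ Fin.castSucc := by
      ext i j
      simp [Matrix.updateRow_apply]
    rw [this, hD.det_minor]
    simp [pow_mul]
  · intro j _ hj
    rw [Matrix.updateRow_self, hrow, if_neg hj]
    simp
  · simp

theorem Formula.isForwardWeight {K ν : Type} [CommRing K] (φ : Formula K ν) :
    IsForwardWeight φ.innerCount (φ.weight 0 0 (2 * φ.innerCount)) := by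
  have key : ∀ i j, φ.weight 0 0 (2 * φ.innerCount) i j ≠ 0 →
      i < j ∧ (i = 0 ∨ i % 2 = 1) ∧ (j = 2 * φ.innerCount ∨ j % 2 = 1) := by
    intro i j h
    have := φ.weight_ne_zero (by omega) h
    unfold Inner at this
    omega
  exact ⟨fun i j h => (key i j h).1, fun i j h => (key i j h).2.1, fun i j h => (key i j h).2.2⟩

/-- every arithmetic formula of size `n` (inputs: variables and constants
0, 1) can be expressed as the hamiltonian of a matrix of size at most `(2n+1)×(2n+1)` and
treewidth at most 6 whose entries are 0, 1, or variables of the formula. -/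
theorem formula_as_bounded_treewidth_hamiltonian {K ν : Type} [Field K]
    (φ : Formula K ν) (hφ : φ.ZeroOneConsts) :
    ∃ m : ℕ, m ≤ 2 * φ.size + 1 ∧
      ∃ M : Matrix (Fin m) (Fin m) (MvPolynomial ν K),
        (∀ i j, M i j = 0 ∨ M i j = 1 ∨ ∃ v ∈ φ.varSet, M i j = MvPolynomial.X v) ∧
        HasTreewidthAtMost (supportGraph M) 6 ∧
        ham M = φ.toPoly := by
  have hD := φ.isForwardWeight
  have h0 : ¬ (0 < 0 ∧ 0 < 0 + 2 * φ.innerCount) := by omega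
  have ht : ¬ (0 < 2 * φ.innerCount ∧ 2 * φ.innerCount < 0 + 2 * φ.innerCount) := by omega
  refine ⟨2 * φ.innerCount + 1, by have := φ.innerCount_le_size; omega,
    returnMatrix φ.innerCount (φ.weight 0 0 (2 * φ.innerCount)), fun i j => ?_, ?_, ?_⟩
  · simp only [returnMatrix, Matrix.of_apply, returnWeight]
    by_cases h : ReturnEdge i j
    · have hz : φ.weight 0 0 (2 * φ.innerCount) i j = 0 := by
        by_contra hz
        have := hD.lt _ _ hz
        unfold ReturnEdge at h
        omega
      rw [if_pos h, hz, add_zero]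
      exact Or.inr (Or.inl rfl)
    · rw [if_neg h, zero_add]
      exact φ.weight_mem hφ (by omega) h0 ht i j
  · obtain ⟨I, _, par, root, X, hX, hcard, -, -, hv, he, hw⟩ :=
      φ.exists_decomposition (a := 0) (by omega) h0 ht
    have hcover : ∀ u v : Fin (2 * φ.innerCount + 1),
        returnMatrix φ.innerCount (φ.weight 0 0 (2 * φ.innerCount)) u v ≠ 0 →
        ∃ i, (u : ℕ) ∈ X i ∧ (v : ℕ) ∈ X i := by
      intro u v huv
      by_cases h : ReturnEdge u v
      · exact he u v (by omega) (by omega) h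
      · simp only [returnMatrix, Matrix.of_apply, returnWeight] at huv
        rw [if_neg h, zero_add] at huv
        exact hw u v huv
    let Y : I → Finset (Fin (2 * φ.innerCount + 1)) := fun i =>
      Finset.univ.filter fun v : Fin (2 * φ.innerCount + 1) => (v : ℕ) ∈ X i
    have hY : ∀ i v, v ∈ Y i ↔ (v : ℕ) ∈ X i := by simp [Y]
    have hdec : IsRootedDecomposition par root Y :=
      ⟨hX.par_eq_none, hX.exists_rank, fun v i j hi hj hi' hj' => by
        simp only [hY] at hi hj hi' hj'
        exact hX.top_unique v i j hi hj hi' hj'⟩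
    refine hdec.hasTreewidthAtMost _ 6 (fun i => ?_) (fun v => ?_) fun u v huv => ?_
    · refine le_trans (Finset.card_le_card_of_injOn (fun v => (v : ℕ)) (fun v h => ?_)
        Fin.val_injective.injOn) (hcard i)
      exact (hY i v).1 h
    · obtain ⟨i, hi⟩ := hv v (by omega) (by omega)
      exact ⟨i, (hY i v).2 hi⟩
    · rcases ((SimpleGraph.fromRel_adj _ _ _).1 huv).2 with h | h
      · obtain ⟨i, hi, hj⟩ := hcover u v h
        exact ⟨i, (hY i u).2 hi, (hY i v).2 hj⟩
      · obtain ⟨i, hi, hj⟩ := hcover v u h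
        exact ⟨i, (hY i u).2 hj, (hY i v).2 hi⟩
  · obtain ⟨P, hP, hPD⟩ := φ.exists_pathSum (by omega) h0 ht
    rw [hD.ham_eq_det φ.innerCount_pos]
    refine hD.det_eq P (fun i hi => ?_) _ fun j => hPD _ (by omega) j
    have := hP i hi
    unfold Formula.Inner at this
    omega
end
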